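/- Let D(n) denote the number of isomorphism classes of connected distance-hereditary simple graphs on n vertices. There exist real constants c > 0, C > 0 and a natural number N such that for all n ≥ N, c · 7.249^n · n^(−5/2) ≤ D(n) ≤ C · 7.25^n · n^(−5/2). -/

import Mathlib

/-- A simple graph is distance-hereditary if in every connected induced subgraph,
distances agree with those in the ambient graph. -/
def DistanceHereditary {V : Type} (G : SimpleGraph V) : Prop :=
  ∀ S : Set V, (G.induce S).Connected →
    ∀ u v : S, (G.induce S).dist u v = G.dist u.val v.val

/-- The number of isomorphism classes of connected distance-hereditary simple graphs
on `n` vertices. -/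
noncomputable def numConnDH (n : ℕ) : ℕ :=
  Nat.card (Quot (fun (G G' : {G : SimpleGraph (Fin n) // G.Connected ∧ DistanceHereditary G}) =>
    Nonempty (G.val ≃g G'.val)))

/-- A graph with some marked vertices, to be thought of as joined to an outer root vertex. -/
structure Marked (V : Type) where
  /-- the underlying graph -/
  G : SimpleGraph V
  /-- the marked vertices -/
  M : V → Prop

namespace Marked

variable {V W U V' W' : Type}

/-- Isomorphism of marked graphs. -/
def Iso (X : Marked V) (Y : Marked W) : Prop :=
  ∃ e : V ≃ W, (∀ u v, Y.G.Adj (e u) (e v) ↔ X.G.Adj u v) ∧ ∀ u, Y.M (e u) ↔ X.M u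

theorem Iso.refl (X : Marked V) : Iso X X := ⟨Equiv.refl _, by simp, by simp⟩

theorem Iso.symm {X : Marked V} {Y : Marked W} : Iso X Y → Iso Y X := by
  rintro ⟨e, h₁, h₂⟩
  refine ⟨e.symm, fun u v => ?_, fun u => ?_⟩
  · rw [← h₁]; simp
  · rw [← h₂]; simp

theorem Iso.trans {X : Marked V} {Y : Marked W} {Z : Marked U} :
    Iso X Y → Iso Y Z → Iso X Z := by
  rintro ⟨e, h₁, h₂⟩ ⟨f, k₁, k₂⟩
  exact ⟨e.trans f, fun u v => by simp [k₁, h₁], fun u => by simp [k₂, h₂]⟩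

/-- Composition of two marked graphs: the marked sets are completely joined if `cr` holds, and
the marked vertices of the second graph stay marked if `mk` holds. -/
def op (cr mk : Prop) (X : Marked V) (Y : Marked W) : Marked (V ⊕ W) where
  G :=
    { Adj := fun
        | .inl a, .inl b => X.G.Adj a b
        | .inr a, .inr b => Y.G.Adj a b
        | .inl a, .inr b => cr ∧ X.M a ∧ Y.M b
        | .inr b, .inl a => cr ∧ X.M a ∧ Y.M b
      symm := by
        constructor
        rintro (a | a) (b | b) h
        · exact h.symm
        · exact h
        · exact h
        · exact h.symm
      loopless := by
        constructor
        rintro (a | a) h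
        · exact X.G.irrefl h
        · exact Y.G.irrefl h }
  M := fun
    | .inl a => X.M a
    | .inr b => mk ∧ Y.M b

section
variable {cr mk : Prop} {X : Marked V} {Y : Marked W}

@[simp] theorem op_adj_inl_inl {a b : V} :
    (op cr mk X Y).G.Adj (.inl a) (.inl b) ↔ X.G.Adj a b := Iff.rfl
@[simp] theorem op_adj_inr_inr {a b : W} :
    (op cr mk X Y).G.Adj (.inr a) (.inr b) ↔ Y.G.Adj a b := Iff.rfl
@[simp] theorem op_adj_inl_inr {a : V} {b : W} :
    (op cr mk X Y).G.Adj (.inl a) (.inr b) ↔ cr ∧ X.M a ∧ Y.M b := Iff.rfl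
@[simp] theorem op_adj_inr_inl {a : V} {b : W} :
    (op cr mk X Y).G.Adj (.inr b) (.inl a) ↔ cr ∧ X.M a ∧ Y.M b := Iff.rfl
@[simp] theorem op_M_inl {a : V} : (op cr mk X Y).M (.inl a) ↔ X.M a := Iff.rfl
@[simp] theorem op_M_inr {b : W} : (op cr mk X Y).M (.inr b) ↔ mk ∧ Y.M b := Iff.rfl
end

theorem op_congr {cr mk : Prop} {X : Marked V} {X' : Marked V'} {Y : Marked W} {Y' : Marked W'}
    (h : Iso X X') (k : Iso Y Y') : Iso (op cr mk X Y) (op cr mk X' Y') := by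
  obtain ⟨e, h₁, h₂⟩ := h
  obtain ⟨f, k₁, k₂⟩ := k
  refine ⟨Equiv.sumCongr e f, ?_, ?_⟩
  · rintro (a | a) (b | b) <;> simp [h₁, h₂, k₁, k₂]
  · rintro (a | a) <;> simp [h₂, k₂]

/-- Complement the edges inside the marked set. -/
def lc (X : Marked V) : Marked V where
  G :=
    { Adj := fun u v => u ≠ v ∧ ((X.M u ∧ X.M v) ↔ ¬ X.G.Adj u v)
      symm := ⟨fun u v h => ⟨h.1.symm, by rw [X.G.adj_comm, ← h.2, and_comm]⟩⟩
      loopless := ⟨fun u h => h.1 rfl⟩ }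
  M := X.M

theorem lc_adj {X : Marked V} {u v : V} :
    (lc X).G.Adj u v ↔ u ≠ v ∧ ((X.M u ∧ X.M v) ↔ ¬ X.G.Adj u v) := Iff.rfl

@[simp] theorem lc_M (X : Marked V) : (lc X).M = X.M := rfl

theorem lc_congr {X : Marked V} {X' : Marked V'} (h : Iso X X') : Iso (lc X) (lc X') := by
  obtain ⟨e, h₁, h₂⟩ := h
  exact ⟨e, fun u v => by simp [lc_adj, h₁, h₂], fun u => by simp [h₂]⟩

theorem lc_lc (X : Marked V) : lc (lc X) = X := by
  obtain ⟨G, M⟩ := X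
  refine congrArg₂ Marked.mk ?_ rfl
  ext u v
  have : G.Adj u v → u ≠ v := fun h => h.ne
  simp only [lc_adj, lc_M]
  tauto

theorem lc_op (cr : Prop) (X : Marked V) (Y : Marked W) :
    Iso (lc (op cr True X Y)) (op (¬ cr) True (lc X) (lc Y)) := by
  refine ⟨Equiv.refl _, ?_, ?_⟩
  · rintro (a | a) (b | b) <;> simp [lc_adj] <;> tauto
  · rintro (a | a) <;> simp

theorem lc_op_false (cr : Prop) (X : Marked V) (Y : Marked W) :
    Iso (lc (op cr False X Y)) (op cr False (lc X) Y) := by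
  refine ⟨Equiv.refl _, ?_, ?_⟩
  · rintro (a | a) (b | b)
    · simp [lc_adj]
    · simp [lc_adj]
    · simp [lc_adj]
    · simpa [lc_adj] using fun h => SimpleGraph.Adj.ne h
  · rintro (a | a) <;> simp

theorem op_comm (cr : Prop) (X : Marked V) (Y : Marked W) :
    Iso (op cr True X Y) (op cr True Y X) := by
  refine ⟨Equiv.sumComm _ _, ?_, ?_⟩
  · rintro (a | a) (b | b) <;> simp [and_comm]
  · rintro (a | a) <;> simp

theorem op_assoc (cr mk : Prop) (X : Marked V) (Y : Marked W) (Z : Marked U) :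
    Iso (op cr mk (op cr mk X Y) Z) (op cr mk X (op (cr ∧ mk) True Y Z)) := by
  refine ⟨Equiv.sumAssoc _ _ _, ?_, ?_⟩
  · rintro ((a | a) | a) ((b | b) | b) <;> simp [and_assoc]
  · rintro ((a | a) | a) <;> simp

/-- The empty marked graph. -/
def empty : Marked Empty := ⟨⊥, fun _ => True⟩

theorem op_empty (cr mk : Prop) (X : Marked V) : Iso (op cr mk X empty) X := by
  refine ⟨Equiv.sumEmpty _ _, ?_, ?_⟩
  · rintro (a | a) (b | b)
    · simp
    all_goals first | exact a.elim | exact b.elim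
  · rintro (a | a)
    · simp
    · exact a.elim

/-- A single marked vertex. -/
def leaf : Marked Unit := ⟨⊥, fun _ => True⟩

theorem lc_leaf : lc leaf = leaf := by
  refine congrArg₂ Marked.mk ?_ rfl
  ext u v
  simp [leaf]

/-- A set of vertices without edges leaving it. -/
def Closed (X : Marked V) (D : Set V) : Prop := ∀ u v, u ∈ D → X.G.Adj u v → v ∈ D

theorem Closed.compl {X : Marked V} {D : Set V} (h : X.Closed D) : X.Closed Dᶜ :=
  fun u v hu huv hv => hu (h v u hv huv.symm)

end Marked

/-- A finite marked graph together with its vertex type. -/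
structure MarkedGraph : Type 1 where
  /-- the vertex type -/
  V : Type
  finite : Finite V
  /-- the graph -/
  graph : Marked V

instance MarkedGraph.setoid : Setoid MarkedGraph :=
  ⟨fun X Y => Marked.Iso X.graph Y.graph, fun _ => .refl _, .symm, .trans⟩

/-- Isomorphism classes of marked graphs. -/
def MarkedClass : Type 1 := Quotient MarkedGraph.setoid

/-- The isomorphism class of a marked graph. -/
def Marked.cls {V : Type} [h : Finite V] (X : Marked V) : MarkedClass :=
  Quotient.mk MarkedGraph.setoid ⟨V, h, X⟩

theorem Marked.cls_eq_iff {V W : Type} [Finite V] [Finite W] {X : Marked V} {Y : Marked W} :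
    X.cls = Y.cls ↔ Marked.Iso X Y := Quotient.eq

namespace MarkedClass
open Marked

theorem ind {p : MarkedClass → Prop}
    (h : ∀ (V : Type) [Finite V] (X : Marked V), p X.cls) (x : MarkedClass) : p x := by
  induction x using Quotient.ind with
  | _ X => have := X.finite; exact h X.V X.graph

/-- Composition of classes. -/
def op (cr mk : Prop) : MarkedClass → MarkedClass → MarkedClass :=
  Quotient.map₂
    (fun X Y => ⟨X.V ⊕ Y.V, have := X.finite; have := Y.finite; inferInstance,
      Marked.op cr mk X.graph Y.graph⟩)
    fun _ _ h _ _ k => op_congr h k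

/-- Complementation inside the marked set, on classes. -/
def lc : MarkedClass → MarkedClass :=
  Quotient.map (fun X => ⟨X.V, X.finite, X.graph.lc⟩) fun _ _ h => lc_congr h

section
variable {V W : Type} [Finite V] [Finite W] (X : Marked V) (Y : Marked W)

theorem op_cls (cr mk : Prop) : op cr mk X.cls Y.cls = (X.op cr mk Y).cls := rfl

theorem lc_cls : lc X.cls = X.lc.cls := rfl
end

/-- The class of a single marked vertex. -/
def leaf : MarkedClass := Marked.leaf.cls

instance : Zero MarkedClass := ⟨Marked.empty.cls⟩
instance : Add MarkedClass := ⟨op False True⟩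

theorem zero_eq : (0 : MarkedClass) = Marked.empty.cls := rfl

theorem add_eq (x y : MarkedClass) : x + y = op False True x y := rfl

theorem op_comm (cr : Prop) (x y : MarkedClass) : op cr True x y = op cr True y x := by
  induction x using ind; induction y using ind
  exact cls_eq_iff.2 (Marked.op_comm _ _ _)

theorem op_zero (cr mk : Prop) (x : MarkedClass) : op cr mk x 0 = x := by
  induction x using ind
  exact cls_eq_iff.2 (op_empty _ _ _)

theorem op_assoc (cr mk : Prop) (x y z : MarkedClass) :
    op cr mk (op cr mk x y) z = op cr mk x (op (cr ∧ mk) True y z) := by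
  induction x using ind; induction y using ind; induction z using ind
  exact cls_eq_iff.2 (Marked.op_assoc _ _ _ _ _)

instance : AddCommMonoid MarkedClass where
  add_assoc x y z := by simpa [add_eq] using op_assoc False True x y z
  zero_add x := (op_comm _ _ _).trans (op_zero _ _ _)
  add_zero x := op_zero _ _ _
  add_comm x y := op_comm _ _ _
  nsmul := nsmulRec

/-- Hang the second class on the first one. -/
def pd (x y : MarkedClass) : MarkedClass := op True False x y

theorem lc_lc (x : MarkedClass) : lc (lc x) = x := by
  induction x using ind
  rw [lc_cls, lc_cls, Marked.lc_lc]

theorem lc_leaf : lc leaf = leaf := by rw [leaf, lc_cls, Marked.lc_leaf]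

theorem lc_add (x y : MarkedClass) : lc (x + y) = op True True (lc x) (lc y) := by
  induction x using ind with | _ V X
  induction y using ind with | _ W Y
  have := cls_eq_iff.2 (lc_op False X Y)
  rw [not_false_eq_true] at this
  exact this

theorem lc_pd (x y : MarkedClass) : lc (pd x y) = pd (lc x) y := by
  induction x using ind; induction y using ind
  exact cls_eq_iff.2 (lc_op_false _ _ _)

theorem pd_pd (x y z : MarkedClass) : pd (pd x y) z = pd x (y + z) := by
  simpa [pd, add_eq] using op_assoc True False x y z

/-- Number of vertices. -/
noncomputable def size : MarkedClass → ℕ :=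
  Quotient.lift (fun X => Nat.card X.V) fun _ _ h => Nat.card_congr h.choose

theorem size_cls {V : Type} [Finite V] (X : Marked V) : size X.cls = Nat.card V := rfl

theorem size_op (cr mk : Prop) (x y : MarkedClass) : size (op cr mk x y) = size x + size y := by
  induction x using ind; induction y using ind
  rw [op_cls, size_cls, size_cls, size_cls, Nat.card_sum]

@[simp] theorem size_add (x y : MarkedClass) : size (x + y) = size x + size y := size_op _ _ x y
@[simp] theorem size_pd (x y : MarkedClass) : size (pd x y) = size x + size y := size_op _ _ x y
@[simp] theorem size_zero : size 0 = 0 := by rw [zero_eq, size_cls]; simp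
@[simp] theorem size_leaf : size leaf = 1 := by rw [leaf, size_cls]; simp
@[simp] theorem size_lc (x : MarkedClass) : size (lc x) = size x := by
  induction x using ind; rfl

/-- The classes built from single vertices by disjoint union, complementation inside the marked
set, and hanging. -/
inductive Good : MarkedClass → Prop
  | leaf : Good leaf
  | add {x y} : Good x → Good y → Good (x + y)
  | lc {x} : Good x → Good (lc x)
  | pd {x y} : Good x → Good y → Good (pd x y)

theorem Good.size_pos {x : MarkedClass} (h : Good x) : 0 < size x := by
  induction h <;> simp <;> omega

end MarkedClass

namespace Marked

variable {V W U V' W' : Type}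

/-- Every nonempty closed set contains a marked vertex. -/
def Hit (X : Marked V) : Prop := ∀ D : Set V, X.Closed D → D.Nonempty → ∃ v ∈ D, X.M v

/-- The underlying graph is connected. -/
def Conn (X : Marked V) : Prop := Nonempty V ∧ ∀ D : Set V, X.Closed D → D.Nonempty → D = Set.univ

/-- A set of unmarked vertices, closed among the unmarked vertices, each of which is adjacent to all
or to none of the marked vertices. -/
structure Hang (X : Marked V) (D : Set V) : Prop where
  not_marked : ∀ v ∈ D, ¬ X.M v
  closed : ∀ u v, u ∈ D → X.G.Adj u v → ¬ X.M v → v ∈ D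
  uniform : ∀ w ∈ D, ∀ a b, X.M a → X.M b → X.G.Adj w a → X.G.Adj w b

theorem Closed.preimage {X : Marked V} {Y : Marked W} {f : V → W}
    (h : ∀ u v, X.G.Adj u v → Y.G.Adj (f u) (f v)) {D : Set W} (hD : Y.Closed D) :
    X.Closed (f ⁻¹' D) := fun u v hu huv => hD _ _ hu (h u v huv)

theorem Iso.hit {X : Marked V} {Y : Marked W} (h : Iso X Y) (hX : X.Hit) : Y.Hit := by
  obtain ⟨e, h₁, h₂⟩ := h
  intro D hD hne
  obtain ⟨v, hv, hm⟩ := hX (e ⁻¹' D) (hD.preimage fun u v => (h₁ u v).2)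
    (hne.preimage e.surjective)
  exact ⟨e v, hv, (h₂ v).2 hm⟩

theorem Iso.conn {X : Marked V} {Y : Marked W} (h : Iso X Y) (hX : X.Conn) : Y.Conn := by
  obtain ⟨e, h₁, h₂⟩ := h
  refine ⟨hX.1.map e, fun D hD hne => ?_⟩
  have := hX.2 (e ⁻¹' D) (hD.preimage fun u v => (h₁ u v).2) (hne.preimage e.surjective)
  rwa [Set.preimage_eq_univ_iff, e.range_eq_univ, Set.univ_subset_iff] at this

theorem Hang.preimage {X : Marked V} {Y : Marked W} {f : V → W}
    (h₁ : ∀ u v, Y.G.Adj (f u) (f v) ↔ X.G.Adj u v) (h₂ : ∀ u, Y.M (f u) ↔ X.M u)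
    {D : Set W} (hD : Y.Hang D) : X.Hang (f ⁻¹' D) where
  not_marked v hv hm := hD.not_marked _ hv ((h₂ v).2 hm)
  closed u v hu huv hv := hD.closed _ _ hu ((h₁ u v).2 huv) (by rwa [h₂])
  uniform w hw a b ha hb hwa := (h₁ w b).1
    (hD.uniform _ hw _ _ ((h₂ a).2 ha) ((h₂ b).2 hb) ((h₁ w a).2 hwa))

/-- There is no nonempty hanging set. -/
def NoHang (X : Marked V) : Prop := ∀ D : Set V, X.Hang D → D = ∅

theorem Iso.noHang {X : Marked V} {Y : Marked W} (h : Iso X Y) (hX : X.NoHang) : Y.NoHang := by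
  obtain ⟨e, h₁, h₂⟩ := h
  intro D hD
  have := hX _ (hD.preimage h₁ h₂)
  rwa [Set.preimage_eq_empty_iff, e.range_eq_univ, Set.disjoint_univ] at this

theorem Hit.exists_marked {X : Marked V} (h : X.Hit) [Nonempty V] : ∃ v, X.M v :=
  let ⟨v, _, hv⟩ := h Set.univ (fun _ _ _ _ => trivial) Set.univ_nonempty
  ⟨v, hv⟩

theorem lc_adj_of_not {X : Marked V} {u v : V} (h : ¬ X.M u) :
    X.lc.G.Adj u v ↔ X.G.Adj u v := by
  have : X.G.Adj u v → u ≠ v := SimpleGraph.Adj.ne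
  rw [lc_adj]
  tauto

theorem Hit.lc {X : Marked V} (h : X.Hit) : X.lc.Hit := by
  intro D hD hne
  by_contra! hc
  have hc' : ∀ v ∈ D, ¬ X.M v := hc
  obtain ⟨v, hv, hm⟩ := h D (fun u v hu huv => hD u v hu ((lc_adj_of_not (hc' u hu)).2 huv)) hne
  exact hc v hv hm

theorem Hang.lc {X : Marked V} {D : Set V} (h : X.Hang D) : X.lc.Hang D where
  not_marked := h.not_marked
  closed u v hu huv hv := h.closed u v hu ((lc_adj_of_not (h.not_marked u hu)).1 huv) hv
  uniform w hw a b ha hb := by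
    rw [lc_adj_of_not (h.not_marked w hw), lc_adj_of_not (h.not_marked w hw)]
    exact h.uniform w hw a b ha hb

theorem NoHang.lc {X : Marked V} (h : X.NoHang) : X.lc.NoHang :=
  fun D hD => h D (lc_lc X ▸ hD.lc)

theorem Hit.op {X : Marked V} {Y : Marked W} (hX : X.Hit) (hY : Y.Hit) {cr mk : Prop}
    (h : (cr ∧ Nonempty V) ∨ mk) : (X.op cr mk Y).Hit := by
  intro D hD hne
  have hl := hD.preimage (X := X) (f := Sum.inl) fun u v => op_adj_inl_inl.2
  have hr := hD.preimage (X := Y) (f := Sum.inr) fun u v => op_adj_inr_inr.2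
  by_cases h₁ : (Sum.inl ⁻¹' D).Nonempty
  · obtain ⟨v, hv, hm⟩ := hX _ hl h₁
    exact ⟨_, hv, hm⟩
  · have h₂ : (Sum.inr ⁻¹' D).Nonempty := by
      obtain ⟨a | a, ha⟩ := hne
      exacts [(h₁ ⟨a, ha⟩).elim, ⟨a, ha⟩]
    obtain ⟨v, hv, hm⟩ := hY _ hr h₂
    obtain ⟨hcr, hV⟩ | hmk := h
    · obtain ⟨a, ha⟩ := hX.exists_marked
      exact ⟨_, hD (.inr v) (.inl a) hv ⟨hcr, ha, hm⟩, ha⟩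
    · exact ⟨_, hv, hmk, hm⟩

theorem conn_op {X : Marked V} {Y : Marked W} (hX : X.Hit) (hY : Y.Hit) [Nonempty V] [Nonempty W]
    (mk : Prop) : (X.op True mk Y).Conn := by
  have key : ∀ D, (X.op True mk Y).Closed D → D.Nonempty → ∀ a, X.M a → Sum.inl a ∈ D := by
    intro D hD hne
    have hl := hD.preimage (X := X) (f := Sum.inl) fun u v => op_adj_inl_inl.2
    have hr := hD.preimage (X := Y) (f := Sum.inr) fun u v => op_adj_inr_inr.2
    suffices ∃ b, Y.M b ∧ Sum.inr b ∈ D by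
      obtain ⟨b, hb, hbD⟩ := this
      exact fun a ha => hD _ _ hbD ⟨trivial, ha, hb⟩
    obtain ⟨a | b, h⟩ := hne
    · obtain ⟨v, hv, hm⟩ := hX _ hl ⟨a, h⟩
      obtain ⟨b, hb⟩ := hY.exists_marked
      exact ⟨b, hb, hD _ _ hv ⟨trivial, hm, hb⟩⟩
    · obtain ⟨v, hv, hm⟩ := hY _ hr ⟨b, h⟩
      exact ⟨v, hm, hv⟩
  refine ⟨inferInstance, fun D hD hne => ?_⟩
  by_contra hc
  obtain ⟨a, ha⟩ := hX.exists_marked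
  exact key _ hD.compl (Set.nonempty_compl.2 hc) a ha (key D hD hne a ha)

theorem not_conn_op (X : Marked V) (Y : Marked W) [Nonempty V] [Nonempty W] :
    ¬ (X.op False True Y).Conn := by
  rintro ⟨-, h⟩
  have := h (Set.range Sum.inl) ?_ (Set.range_nonempty _)
  · obtain ⟨b⟩ := ‹Nonempty W›
    have hb : (Sum.inr b : V ⊕ W) ∈ Set.range Sum.inl := this ▸ trivial
    simp at hb
  · rintro _ (v | v) ⟨u, rfl⟩ huv
    · simp
    · simp at huv

theorem noHang_op {X : Marked V} {Y : Marked W} (hX : X.Hit) (hY : Y.Hit) [Nonempty V]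
    [Nonempty W] : (X.op False True Y).NoHang := by
  intro D hD
  obtain ⟨a, ha⟩ := hX.exists_marked
  obtain ⟨b, hb⟩ := hY.exists_marked
  have h₁ : Sum.inl ⁻¹' D = ∅ := by
    by_contra hne
    obtain ⟨v, hv, hm⟩ := hX (Sum.inl ⁻¹' D) (fun u v hu huv => hD.closed _ _ hu
      (op_adj_inl_inl.2 huv) fun hm => by
        simpa using hD.uniform _ hu (.inl v) (.inr b) hm ⟨trivial, hb⟩ huv)
      (Set.nonempty_iff_ne_empty.2 hne)
    exact hD.not_marked _ hv hm
  have h₂ : Sum.inr ⁻¹' D = ∅ := by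
    by_contra hne
    obtain ⟨v, hv, hm⟩ := hY (Sum.inr ⁻¹' D) (fun u v hu huv => hD.closed _ _ hu
      (op_adj_inr_inr.2 huv) fun hm => by
        simpa using hD.uniform _ hu (.inr v) (.inl a) hm ha huv)
      (Set.nonempty_iff_ne_empty.2 hne)
    exact hD.not_marked _ hv ⟨trivial, hm⟩
  ext (u | u)
  · exact iff_of_false (fun h => (h₁ ▸ h : u ∈ (∅ : Set V))) id
  · exact iff_of_false (fun h => (h₂ ▸ h : u ∈ (∅ : Set W))) id

theorem hang_range_inr (X : Marked V) (Y : Marked W) :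
    (X.op True False Y).Hang (Set.range Sum.inr) where
  not_marked := by rintro _ ⟨b, rfl⟩ h; simp at h
  closed := by rintro _ (v | v) ⟨b, rfl⟩ h hv <;> simp_all
  uniform := by rintro _ ⟨b, rfl⟩ (v | v) (w | w) <;> simp_all

theorem Hang.subset_range_inr {X : Marked V} {Y : Marked W} (hX : X.NoHang) {D : Set (V ⊕ W)}
    (hD : (X.op True False Y).Hang D) : D ⊆ Set.range Sum.inr := by
  have := hX (Sum.inl ⁻¹' D) (hD.preimage (fun _ _ => op_adj_inl_inl) fun _ => op_M_inl)
  rintro (a | a) ha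
  · exact ((this ▸ ha : a ∈ (∅ : Set V))).elim
  · simp

theorem iso_of_sum {X : Marked V} {Y : Marked W} {X' : Marked V'} {Y' : Marked W'}
    (hX : X.NoHang) (hX' : X'.NoHang) (hne : ∃ a, X.M a)
    (h : Iso (X.op True False Y) (X'.op True False Y')) : Iso X X' ∧ Iso Y Y' := by
  have key : ∀ {V W V' W' : Type} {X : Marked V} {Y : Marked W} {X' : Marked V'} {Y' : Marked W'}
      (_ : X.NoHang) (e : V ⊕ W ≃ V' ⊕ W')
      (_ : ∀ u v, (X'.op True False Y').G.Adj (e u) (e v) ↔ (X.op True False Y).G.Adj u v)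
      (_ : ∀ u, (X'.op True False Y').M (e u) ↔ (X.op True False Y).M u),
      ∀ a, ∃ a', e (.inl a) = .inl a' := by
    intro V W V' W' X Y X' Y' hX e h₁ h₂ a
    have := Hang.subset_range_inr hX ((hang_range_inr X' Y').preimage h₁ h₂)
    rcases hea : e (.inl a) with a' | b'
    · exact ⟨a', rfl⟩
    · have : (Sum.inl a : V ⊕ W) ∈ Set.range Sum.inr := this ⟨b', hea.symm⟩
      simp at this
  obtain ⟨e, h₁, h₂⟩ := h
  have k₁ : ∀ u v, (X.op True False Y).G.Adj (e.symm u) (e.symm v) ↔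
      (X'.op True False Y').G.Adj u v := fun u v => by rw [← h₁]; simp
  have k₂ : ∀ u, (X.op True False Y).M (e.symm u) ↔ (X'.op True False Y').M u :=
    fun u => by rw [← h₂]; simp
  choose f hf using key hX e h₁ h₂
  choose g hg using key hX' e.symm k₁ k₂
  have hf' : ∀ b, ∃ b', e (.inr b) = .inr b' := by
    intro b
    rcases heb : e (.inr b) with a' | b'
    · have := hg a'
      rw [← heb] at this
      simp at this
    · exact ⟨b', rfl⟩
  have hg' : ∀ b, ∃ b', e.symm (.inr b) = .inr b' := by
    intro b
    rcases heb : e.symm (.inr b) with a' | b'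
    · have := hf a'
      rw [← heb] at this
      simp at this
    · exact ⟨b', rfl⟩
  choose f' hf' using hf'
  choose g' hg' using hg'
  refine ⟨⟨⟨f, g, fun a => ?_, fun a => ?_⟩, fun u v => ?_, fun u => ?_⟩,
    ⟨⟨f', g', fun b => ?_, fun b => ?_⟩, fun u v => ?_, fun u => ?_⟩⟩
  · have := hg (f a); rw [← hf] at this; simpa using this.symm
  · have := hf (g a); rw [← hg] at this; simpa using this.symm
  · simpa [hf] using h₁ (.inl u) (.inl v)
  · simpa [hf] using h₂ (.inl u)
  · have := hg' (f' b); rw [← hf'] at this; simpa using this.symm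
  · have := hf' (g' b); rw [← hg'] at this; simpa using this.symm
  · simpa [hf'] using h₁ (.inr u) (.inr v)
  · obtain ⟨a, ha⟩ := hne
    have := h₁ (.inl a) (.inr u)
    have ha' : X'.M (f a) := by simpa [hf, ha] using h₂ (.inl a)
    simpa [hf, hf', ha, ha'] using this

/-- The marked graph induced on a set of vertices. -/
def restrict (X : Marked V) (D : Set V) : Marked D := ⟨X.G.induce D, fun v => X.M v⟩

/-- Minimal nonempty closed sets, that is, connected components. -/
def MinClosed (X : Marked V) (D : Set V) : Prop :=
  D.Nonempty ∧ X.Closed D ∧ ∀ D' ⊆ D, D'.Nonempty → X.Closed D' → D' = D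

/-- The classes of the connected components. -/
noncomputable def comps [Finite V] (X : Marked V) : Multiset MarkedClass :=
  ∑ᶠ D ∈ {D | X.MinClosed D}, {(X.restrict D).cls}

/-- A full embedding onto a closed set. -/
structure Emb (X : Marked V) (Y : Marked W) (f : V → W) : Prop where
  inj : Function.Injective f
  adj : ∀ u v, Y.G.Adj (f u) (f v) ↔ X.G.Adj u v
  marked : ∀ u, Y.M (f u) ↔ X.M u
  closed : Y.Closed (Set.range f)

theorem Emb.minClosed {X : Marked V} {Y : Marked W} {f : V → W} (h : Emb X Y f) :
    {D | Y.MinClosed D ∧ D ⊆ Set.range f} = (f '' ·) '' {D | X.MinClosed D} := by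
  have himg : ∀ D, X.Closed D → Y.Closed (f '' D) := by
    rintro D hD _ v ⟨u, hu, rfl⟩ huv
    obtain ⟨v, rfl⟩ := h.closed _ _ ⟨u, rfl⟩ huv
    exact ⟨v, hD u v hu ((h.adj u v).1 huv), rfl⟩
  have hpre : ∀ D, Y.Closed D → X.Closed (f ⁻¹' D) :=
    fun D hD => hD.preimage fun u v => (h.adj u v).2
  ext D
  constructor
  · rintro ⟨⟨hne, hcl, hmin⟩, hsub⟩
    refine ⟨f ⁻¹' D, ⟨hne.preimage' hsub, hpre D hcl, fun D' hD' hne' hcl' => ?_⟩,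
      Set.image_preimage_eq_of_subset hsub⟩
    rw [← hmin (f '' D') (Set.image_subset_iff.2 hD') (hne'.image f) (himg D' hcl'),
      Set.preimage_image_eq _ h.inj]
  · rintro ⟨D, ⟨hne, hcl, hmin⟩, rfl⟩
    refine ⟨⟨hne.image f, himg D hcl, fun D' hD' hne' hcl' => ?_⟩, Set.image_subset_range _ _⟩
    have hsub := hD'.trans (Set.image_subset_range _ _)
    have := hmin (f ⁻¹' D')
      (by rw [← Set.preimage_image_eq D h.inj]; exact Set.preimage_mono hD')
      (hne'.preimage' hsub) (hpre D' hcl')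
    show D' = f '' D
    rw [← this, Set.image_preimage_eq_of_subset hsub]

theorem Emb.sum_comps [Finite V] [Finite W] {X : Marked V} {Y : Marked W} {f : V → W}
    (h : Emb X Y f) :
    ∑ᶠ D ∈ {D | Y.MinClosed D ∧ D ⊆ Set.range f}, {(Y.restrict D).cls} = X.comps := by
  rw [h.minClosed, finsum_mem_image h.inj.image_injective.injOn, comps]
  refine finsum_mem_congr rfl fun D _ => ?_
  rw [Multiset.singleton_inj, cls_eq_iff]
  refine Iso.symm ⟨Equiv.Set.image f D h.inj, fun u v => ?_, fun u => ?_⟩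
  · exact h.adj u v
  · exact h.marked u

theorem Iso.comps_eq [Finite V] [Finite W] {X : Marked V} {Y : Marked W} (h : Iso X Y) :
    X.comps = Y.comps := by
  obtain ⟨e, h₁, h₂⟩ := h
  have : Emb X Y e := ⟨e.injective, h₁, h₂, by simp [Closed]⟩
  rw [← this.sum_comps]
  simp [comps]

theorem comps_op [Finite V] [Finite W] (X : Marked V) (Y : Marked W) :
    (X.op False True Y).comps = X.comps + Y.comps := by
  set Z := X.op False True Y
  have hl : Emb X Z Sum.inl := ⟨Sum.inl_injective, fun _ _ => Iff.rfl, fun _ => Iff.rfl, by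
    rintro _ (v | v) ⟨u, rfl⟩ huv <;> simp_all [Z]⟩
  have hr : Emb Y Z Sum.inr := ⟨Sum.inr_injective, fun _ _ => Iff.rfl, fun _ => by simp [Z], by
    rintro _ (v | v) ⟨u, rfl⟩ huv <;> simp_all [Z]⟩
  rw [← hl.sum_comps, ← hr.sum_comps, ← finsum_mem_union _ (Set.toFinite _) (Set.toFinite _)]
  · refine finsum_mem_congr ?_ fun _ _ => rfl
    have key : ∀ D E : Set (V ⊕ W), Z.MinClosed D → Z.Closed E → (D ∩ E).Nonempty → D ⊆ E := by
      intro D E hD hE hne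
      rw [← hD.2.2 (D ∩ E) Set.inter_subset_left hne
        fun u v hu huv => ⟨hD.2.1 u v hu.1 huv, hE u v hu.2 huv⟩]
      exact Set.inter_subset_right
    ext D
    refine ⟨fun hD => ?_, fun hD => hD.elim And.left And.left⟩
    obtain ⟨a | a, ha⟩ := hD.1
    · exact Or.inl ⟨hD, key _ _ hD hl.closed ⟨_, ha, a, rfl⟩⟩
    · exact Or.inr ⟨hD, key _ _ hD hr.closed ⟨_, ha, a, rfl⟩⟩
  · rw [Set.disjoint_left]
    rintro D ⟨hD, h₁⟩ ⟨-, h₂⟩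
    obtain ⟨x, hx⟩ := hD.1
    obtain ⟨a, rfl⟩ := h₁ hx
    obtain ⟨b, hb⟩ := h₂ hx
    simp at hb

theorem comps_of_conn [Finite V] {X : Marked V} (h : X.Conn) : X.comps = {X.cls} := by
  have : {D | X.MinClosed D} = {Set.univ} := by
    ext D
    constructor
    · rintro ⟨hne, hcl, -⟩
      exact h.2 D hcl hne
    · rintro rfl
      exact ⟨@Set.univ_nonempty V h.1, fun _ _ _ _ => trivial,
        fun D' _ hne hcl => h.2 D' hcl hne⟩
  rw [comps, this, finsum_mem_singleton, Multiset.singleton_inj, cls_eq_iff]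
  exact ⟨Equiv.Set.univ V, fun u v => Iff.rfl, fun u => Iff.rfl⟩

theorem comps_empty : empty.comps = 0 := by
  have : {D | empty.MinClosed D} = ∅ := by
    ext D
    refine iff_of_false (fun h => ?_) id
    obtain ⟨⟨x⟩, -⟩ := h.1
  rw [comps, this, finsum_mem_empty]

end Marked

namespace MarkedClass
open Marked

/-- Every component contains a marked vertex. -/
def Hit : MarkedClass → Prop :=
  Quotient.lift (fun X => X.graph.Hit) fun _ _ h => propext ⟨Iso.hit h, Iso.hit h.symm⟩

/-- The underlying graph is connected. -/
def Conn : MarkedClass → Prop :=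
  Quotient.lift (fun X => X.graph.Conn) fun _ _ h => propext ⟨Iso.conn h, Iso.conn h.symm⟩

/-- There is no nonempty hanging set. -/
def NoHang : MarkedClass → Prop :=
  Quotient.lift (fun X => X.graph.NoHang) fun _ _ h => propext ⟨Iso.noHang h, Iso.noHang h.symm⟩

/-- The classes of the connected components. -/
noncomputable def comps : MarkedClass → Multiset MarkedClass :=
  Quotient.lift (fun X => have := X.finite; X.graph.comps) fun X Y h =>
    have := X.finite; have := Y.finite; Iso.comps_eq h

theorem comps_add (x y : MarkedClass) : comps (x + y) = comps x + comps y := by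
  induction x using ind with | _ V X
  induction y using ind with | _ W Y
  exact comps_op X Y

theorem comps_of_conn {x : MarkedClass} : Conn x → comps x = {x} := by
  induction x using ind with | _ V X
  exact Marked.comps_of_conn

theorem comps_sum {s : Multiset MarkedClass} (h : ∀ x ∈ s, Conn x) : comps s.sum = s := by
  induction s using Multiset.induction with
  | empty => exact comps_empty
  | cons a s ih =>
    rw [Multiset.sum_cons, comps_add, comps_of_conn (h a (Multiset.mem_cons_self a s)),
      ih fun x hx => h x (Multiset.mem_cons_of_mem hx), Multiset.singleton_add]

theorem nonempty_of_size_pos {V : Type} [Finite V] {X : Marked V} (h : 0 < size X.cls) :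
    Nonempty V := (Nat.card_pos_iff.1 h).1

theorem Good.hit {x : MarkedClass} (h : Good x) : Hit x := by
  induction h with
  | leaf => exact fun D _ ⟨v, hv⟩ => ⟨v, hv, trivial⟩
  | @add x y _ _ hx hy =>
    induction x using ind with | _ V X
    induction y using ind with | _ W Y
    exact Marked.Hit.op hx hy (Or.inr trivial)
  | @lc x _ hx =>
    induction x using ind with | _ V X
    exact Marked.Hit.lc hx
  | @pd x y gx _ hx hy =>
    induction x using ind with | _ V X
    induction y using ind with | _ W Y
    exact Marked.Hit.op hx hy (Or.inl ⟨trivial, nonempty_of_size_pos gx.size_pos⟩)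

theorem Good.conn_op {x y : MarkedClass} (hx : Good x) (hy : Good y) (mk : Prop) :
    Conn (op True mk x y) := by
  have h₁ := hx.hit
  have h₂ := hy.hit
  have h₃ := hx.size_pos
  have h₄ := hy.size_pos
  induction x using ind with | _ V X
  induction y using ind with | _ W Y
  have := nonempty_of_size_pos h₃
  have := nonempty_of_size_pos h₄
  exact Marked.conn_op h₁ h₂ mk

theorem Good.not_conn_add {x y : MarkedClass} (hx : Good x) (hy : Good y) : ¬ Conn (x + y) := by
  have h₃ := hx.size_pos
  have h₄ := hy.size_pos
  induction x using ind with | _ V X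
  induction y using ind with | _ W Y
  have := nonempty_of_size_pos h₃
  have := nonempty_of_size_pos h₄
  exact Marked.not_conn_op X Y

theorem Good.noHang_add {x y : MarkedClass} (hx : Good x) (hy : Good y) : NoHang (x + y) := by
  have h₁ := hx.hit
  have h₂ := hy.hit
  have h₃ := hx.size_pos
  have h₄ := hy.size_pos
  induction x using ind with | _ V X
  induction y using ind with | _ W Y
  have := nonempty_of_size_pos h₃
  have := nonempty_of_size_pos h₄
  exact Marked.noHang_op h₁ h₂

theorem conn_leaf : Conn leaf :=
  ⟨⟨()⟩, fun _ _ ⟨_, hx⟩ => Set.eq_univ_of_forall fun _ => hx⟩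

theorem noHang_lc {x : MarkedClass} : NoHang x → NoHang (lc x) := by
  induction x using ind with | _ V X
  exact Marked.NoHang.lc

theorem noHang_leaf : NoHang leaf :=
  fun _ hD => Set.eq_empty_of_forall_notMem fun v hv => hD.not_marked v hv trivial

/-- Classes arising by hanging one good class on another. -/
def IsPd (x : MarkedClass) : Prop := ∃ a b, Good a ∧ Good b ∧ x = pd a b

theorem Good.cases {x : MarkedClass} (h : Good x) : x = MarkedClass.leaf ∨
    (∃ a b, Good a ∧ Good b ∧ x = a + b) ∨ (∃ a b, Good a ∧ Good b ∧ x = MarkedClass.lc (a + b)) ∨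
    IsPd x := by
  induction h with
  | leaf => exact Or.inl rfl
  | @add x y hx hy => exact Or.inr (Or.inl ⟨x, y, hx, hy, rfl⟩)
  | @lc x hx ih =>
    obtain rfl | ⟨a, b, ha, hb, rfl⟩ | ⟨a, b, ha, hb, rfl⟩ | ⟨a, b, ha, hb, rfl⟩ := ih
    · exact Or.inl lc_leaf
    · exact Or.inr (Or.inr (Or.inl ⟨a, b, ha, hb, rfl⟩))
    · exact Or.inr (Or.inl ⟨a, b, ha, hb, lc_lc _⟩)
    · exact Or.inr (Or.inr (Or.inr ⟨_, b, ha.lc, hb, lc_pd _ _⟩))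
  | @pd x y hx hy => exact Or.inr (Or.inr (Or.inr ⟨x, y, hx, hy, rfl⟩))

theorem IsPd.conn {x : MarkedClass} : IsPd x → Conn x := by
  rintro ⟨a, b, ha, hb, rfl⟩; exact ha.conn_op hb _

theorem IsPd.lc {x : MarkedClass} : IsPd x → IsPd (lc x) := by
  rintro ⟨a, b, ha, hb, rfl⟩; exact ⟨_, b, ha.lc, hb, lc_pd _ _⟩

theorem not_isPd_leaf : ¬ IsPd leaf := by
  rintro ⟨a, b, ha, hb, h⟩
  have := congrArg size h
  have := ha.size_pos
  have := hb.size_pos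
  simp at *
  omega

theorem Good.conn_lc_add {x y : MarkedClass} (hx : Good x) (hy : Good y) :
    Conn (MarkedClass.lc (x + y)) := by
  rw [lc_add]; exact hx.lc.conn_op hy.lc _

theorem Good.exists_add {x : MarkedClass} (h : Good x) (hc : ¬ Conn x) :
    ∃ a b, Good a ∧ Good b ∧ x = a + b := by
  obtain rfl | h | ⟨a, b, ha, hb, rfl⟩ | h := h.cases
  · exact (hc conn_leaf).elim
  · exact h
  · exact (hc (ha.conn_lc_add hb)).elim
  · exact (hc h.conn).elim

theorem Good.conn_lc {x : MarkedClass} (h : Good x) (hc : ¬ Conn x) :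
    Conn (MarkedClass.lc x) := by
  obtain ⟨a, b, ha, hb, rfl⟩ := h.exists_add hc
  exact ha.conn_lc_add hb

theorem Good.eq_leaf_or_isPd {x : MarkedClass} (h : Good x) (hc : Conn x)
    (hl : Conn (MarkedClass.lc x)) : x = MarkedClass.leaf ∨ IsPd x := by
  obtain h | ⟨a, b, ha, hb, rfl⟩ | ⟨a, b, ha, hb, rfl⟩ | h := h.cases
  · exact Or.inl h
  · exact (ha.not_conn_add hb hc).elim
  · rw [lc_lc] at hl
    exact (ha.not_conn_add hb hl).elim
  · exact Or.inr h

theorem Good.noHang {x : MarkedClass} (h : Good x) (hp : ¬ IsPd x) : NoHang x := by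
  obtain rfl | ⟨a, b, ha, hb, rfl⟩ | ⟨a, b, ha, hb, rfl⟩ | h := h.cases
  · exact noHang_leaf
  · exact ha.noHang_add hb
  · exact noHang_lc (ha.noHang_add hb)
  · exact (hp h).elim

theorem pd_inj {x y x' y' : MarkedClass} (hx : Good x) (px : ¬ IsPd x) (hx' : Good x')
    (px' : ¬ IsPd x') (h : pd x y = pd x' y') : x = x' ∧ y = y' := by
  have h₁ := hx.noHang px
  have h₂ := hx'.noHang px'
  have h₃ := hx.size_pos
  have h₄ := hx.hit
  induction x using ind with | _ V X
  induction y using ind with | _ W Y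
  induction x' using ind with | _ V' X'
  induction y' using ind with | _ W' Y'
  have := nonempty_of_size_pos h₃
  rw [cls_eq_iff, cls_eq_iff]
  exact iso_of_sum h₁ h₂ h₄.exists_marked (cls_eq_iff.1 h)

theorem IsPd.exists_not_isPd {x : MarkedClass} (h : IsPd x) :
    ∃ a b, Good a ∧ ¬ IsPd a ∧ Good b ∧ x = pd a b := by
  obtain ⟨a, b, ha, hb, rfl⟩ := h
  induction hn : size a using Nat.strong_induction_on generalizing a b with
  | _ n ih =>
    by_cases hp : IsPd a
    · obtain ⟨c, d, hc, hd, rfl⟩ := hp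
      have := hd.size_pos
      rw [pd_pd]
      exact ih (size c) (by simp at hn; omega) c _ hc (hd.add hb) rfl
    · exact ⟨a, b, ha, hp, hb, rfl⟩

theorem Good.exists_multiset {x : MarkedClass} (h : Good x) :
    ∃ s : Multiset MarkedClass, (∀ p ∈ s, Good p ∧ Conn p) ∧ s.sum = x := by
  induction hn : size x using Nat.strong_induction_on generalizing x with
  | _ n ih =>
    by_cases hc : Conn x
    · exact ⟨{x}, by simp [h, hc], by simp⟩
    · obtain ⟨a, b, ha, hb, rfl⟩ := h.exists_add hc
      have := ha.size_pos
      have := hb.size_pos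
      simp at hn
      obtain ⟨s, hs, rfl⟩ := ih (size a) (by omega) ha rfl
      obtain ⟨t, ht, rfl⟩ := ih (size b) (by omega) hb rfl
      exact ⟨s + t, fun p hp => (Multiset.mem_add.1 hp).elim (hs p) (ht p), by simp⟩

theorem good_sum {s : Multiset MarkedClass} (h : ∀ p ∈ s, Good p) (hs : s ≠ 0) : Good s.sum := by
  induction s using Multiset.induction with
  | empty => exact (hs rfl).elim
  | cons a s ih =>
    rw [Multiset.sum_cons]
    have ha := h a (Multiset.mem_cons_self a s)
    obtain rfl | hs := eq_or_ne s 0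
    · simpa using ha
    · exact ha.add (ih (fun p hp => h p (Multiset.mem_cons_of_mem hp)) hs)

theorem Good.comps {x : MarkedClass} (h : Good x) :
    (∀ p ∈ comps x, Good p ∧ Conn p) ∧ (comps x).sum = x := by
  obtain ⟨s, hs, rfl⟩ := h.exists_multiset
  rw [comps_sum fun p hp => (hs p hp).2]
  exact ⟨hs, rfl⟩

end MarkedClass

section
open Finset Filter Topology

section GeometricProduct
variable {α : Type*}

/-- A multiset on `insert a F` consists of copies of `a` and a multiset on `F`. -/
theorem hasSum_multiset_insert [DecidableEq α] {F : Finset α} {w : α → ℝ} {a : α} (ha : a ∉ F)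
    (h₀ : ∀ a, 0 ≤ w a) (h₁ : w a < 1) {t : ℝ}
    (h : HasSum (fun s : {s : Multiset α // ∀ a ∈ s, a ∈ F} => (s.1.map w).prod) t) :
    HasSum (fun s : {s : Multiset α // ∀ b ∈ s, b ∈ insert a F} => (s.1.map w).prod)
      ((1 - w a)⁻¹ * t) := by
  let e : ℕ × {s : Multiset α // ∀ a ∈ s, a ∈ F} ≃
      {s : Multiset α // ∀ b ∈ s, b ∈ insert a F} :=
    { toFun := fun x => ⟨Multiset.replicate x.1 a + x.2.1, fun b hb => by
        rcases Multiset.mem_add.1 hb with hb | hb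
        · exact mem_insert.2 (Or.inl (Multiset.eq_of_mem_replicate hb))
        · exact mem_insert_of_mem (x.2.2 b hb)⟩
      invFun := fun s => ⟨s.1.count a, s.1.filter (fun b => ¬ a = b), fun b hb => by
        rw [Multiset.mem_filter] at hb
        exact (mem_insert.1 (s.2 b hb.1)).resolve_left fun h => hb.2 h.symm⟩
      left_inv := by
        rintro ⟨n, s, hs⟩
        have h₁ : a ∉ s := fun h => ha (hs a h)
        refine Prod.ext ?_ (Subtype.ext ?_)
        · simp [Multiset.count_eq_zero_of_notMem h₁]
        · simp only [Multiset.filter_add]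
          rw [Multiset.filter_eq_nil.2 (by simp +contextual [Multiset.mem_replicate]),
            Multiset.filter_eq_self.2 (by rintro b hb rfl; exact h₁ hb), zero_add]
      right_inv := by
        rintro ⟨s, hs⟩
        refine Subtype.ext ?_
        change Multiset.replicate (s.count a) a + s.filter (fun b => ¬ a = b) = s
        rw [← Multiset.filter_eq, Multiset.filter_add_not] }
  rw [← e.hasSum_iff]
  have hg := hasSum_geometric_of_lt_one (h₀ a) h₁
  have hp : ∀ s : Multiset α, 0 ≤ (s.map w).prod := fun s =>
    Multiset.prod_nonneg (by simpa using fun c _ => h₀ c)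
  have key := hg.mul h (hg.summable.mul_of_nonneg h.summable (fun n => pow_nonneg (h₀ a) n)
    fun s => hp s.1)
  have he : (fun s : {s : Multiset α // ∀ b ∈ s, b ∈ insert a F} => (s.1.map w).prod) ∘ e =
      fun x => w a ^ x.1 * (x.2.1.map w).prod := by
    ext x
    simp [e]
  rw [he]
  exact key

theorem hasSum_multiset (F : Finset α) {w : α → ℝ} (h₀ : ∀ a, 0 ≤ w a)
    (h₁ : ∀ a ∈ F, w a < 1) :
    HasSum (fun s : {s : Multiset α // ∀ a ∈ s, a ∈ F} => (s.1.map w).prod)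
      (∏ a ∈ F, (1 - w a)⁻¹) := by
  classical
  induction F using Finset.induction_on with
  | empty =>
    have : ∀ s : {s : Multiset α // ∀ a ∈ s, a ∈ (∅ : Finset α)}, s = ⟨0, by simp⟩ :=
      fun s => Subtype.ext (Multiset.eq_zero_of_forall_notMem fun a ha => by simpa using s.2 a ha)
    convert hasSum_single (⟨0, fun _ h => (Multiset.notMem_zero _ h).elim⟩ :
      {s : Multiset α // ∀ a ∈ s, a ∈ (∅ : Finset α)}) fun s hs => (hs (this s)).elim
    simp
  | insert a F ha ih =>
    rw [prod_insert ha]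
    exact hasSum_multiset_insert ha h₀ (h₁ a (mem_insert_self a F))
      (ih fun b hb => h₁ b (mem_insert_of_mem hb))
end GeometricProduct

namespace MarkedClass

theorem finite_size_eq (n : ℕ) : {x : MarkedClass | size x = n}.Finite := by
  refine (Set.finite_range fun q : SimpleGraph (Fin n) × (Fin n → Prop) =>
    (Marked.mk q.1 q.2).cls).subset ?_
  rintro x hx
  induction x using ind with | _ V X
  obtain e : V ≃ Fin n := Finite.equivFinOfCardEq hx
  refine ⟨⟨X.G.map e.toEmbedding, X.M ∘ e.symm⟩, ?_⟩
  exact (Marked.cls_eq_iff.2 ⟨e, fun u v => SimpleGraph.map_adj_apply, fun u => by simp⟩).symm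

/-- The good classes of size `n` with property `Q`. -/
noncomputable def level (Q : MarkedClass → Prop) (n : ℕ) : Finset MarkedClass :=
  ((finite_size_eq n).subset fun x (h : Good x ∧ Q x ∧ size x = n) => h.2.2).toFinset

variable {Q : MarkedClass → Prop} {n : ℕ} {x : MarkedClass}

@[simp] theorem mem_level : x ∈ level Q n ↔ Good x ∧ Q x ∧ size x = n :=
  Set.Finite.mem_toFinset _

/-- The good classes of size at most `n` with property `Q`. -/
noncomputable def upTo (Q : MarkedClass → Prop) (n : ℕ) : Finset MarkedClass :=
  open Classical in (range (n + 1)).biUnion (level Q)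

@[simp] theorem mem_upTo : x ∈ upTo Q n ↔ Good x ∧ Q x ∧ size x ≤ n := by
  simp [upTo]; tauto

/-- The number of good classes of size `n` with property `Q`. -/
noncomputable def cnt (Q : MarkedClass → Prop) (n : ℕ) : ℕ := (level Q n).card

theorem cnt_zero (Q : MarkedClass → Prop) : cnt Q 0 = 0 := by
  rw [cnt, card_eq_zero, eq_empty_iff_forall_notMem]
  intro x hx
  rw [mem_level] at hx
  have := hx.1.size_pos
  omega

theorem filter_upTo {j : ℕ} (hj : j ≤ n) : {x ∈ upTo Q n | size x = j} = level Q j := by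
  ext x
  simp only [mem_filter, mem_upTo, mem_level]
  constructor
  · tauto
  · rintro ⟨h₁, h₂, rfl⟩
    exact ⟨⟨h₁, h₂, hj⟩, rfl⟩

theorem sum_upTo (Q : MarkedClass → Prop) (n : ℕ) (f : ℕ → ℝ) :
    ∑ x ∈ upTo Q n, f (size x) = ∑ j ∈ range (n + 1), cnt Q j * f j := by
  rw [← sum_fiberwise_of_maps_to (g := size) (t := range (n + 1))
    (fun x hx => by simp only [mem_upTo] at hx; simp; omega)]
  refine sum_congr rfl fun j hj => ?_
  rw [filter_upTo (by simp at hj; omega), sum_congr rfl fun x hx => by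
    rw [(mem_level.1 hx).2.2], sum_const, cnt, nsmul_eq_mul]

theorem prod_upTo (Q : MarkedClass → Prop) (n : ℕ) (f : ℕ → ℝ) :
    ∏ x ∈ upTo Q n, f (size x) = ∏ j ∈ range (n + 1), f j ^ cnt Q j := by
  rw [← prod_fiberwise_of_maps_to (g := size) (t := range (n + 1))
    (fun x hx => by simp only [mem_upTo] at hx; simp; omega)]
  refine prod_congr rfl fun j hj => ?_
  rw [filter_upTo (by simp at hj; omega), prod_congr rfl fun x hx => by
    rw [(mem_level.1 hx).2.2], prod_const, cnt]

/-- The number of good classes of size `n`. -/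
noncomputable abbrev numAll : ℕ → ℕ := cnt fun _ => True
/-- The number of connected good classes of size `n`. -/
noncomputable abbrev numConn : ℕ → ℕ := cnt Conn
/-- The number of disconnected good classes of size `n`. -/
noncomputable abbrev numDisc : ℕ → ℕ := cnt fun x => ¬ Conn x
/-- The number of classes of size `n` obtained by hanging. -/
noncomputable abbrev numPd : ℕ → ℕ := cnt IsPd
/-- The number of good classes of size `n` not obtained by hanging. -/
noncomputable abbrev numCore : ℕ → ℕ := cnt fun x => ¬ IsPd x

theorem cnt_add_cnt_not (P Q : MarkedClass → Prop) (n : ℕ) :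
    cnt (fun x => P x ∧ Q x) n + cnt (fun x => P x ∧ ¬ Q x) n = cnt P n := by
  classical
  rw [cnt, cnt, cnt, ← card_filter_add_card_filter_not (s := level P n) Q]
  congr 2 <;> ext x <;> simp <;> tauto

theorem cnt_congr {P Q : MarkedClass → Prop} (h : ∀ x, Good x → (P x ↔ Q x)) (n : ℕ) :
    cnt P n = cnt Q n := by
  rw [cnt, cnt]
  congr 1
  ext x
  simp only [mem_level]
  have := h x
  tauto

theorem numConn_add_numDisc (n : ℕ) : numConn n + numDisc n = numAll n := by
  simpa using cnt_add_cnt_not (fun _ => True) Conn n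

theorem numPd_add_numCore (n : ℕ) : numPd n + numCore n = numAll n := by
  simpa using cnt_add_cnt_not (fun _ => True) IsPd n

theorem cnt_conn_not_conn_lc (n : ℕ) :
    cnt (fun x => Conn x ∧ ¬ Conn (lc x)) n = numDisc n := by
  refine card_nbij' lc lc ?_ ?_ (fun x _ => lc_lc x) (fun x _ => lc_lc x)
  · intro x hx
    simp only [mem_coe, mem_level] at hx ⊢
    exact ⟨hx.1.lc, hx.2.1.2, by simp [hx.2.2]⟩
  · intro x hx
    simp only [mem_coe, mem_level] at hx ⊢
    exact ⟨hx.1.lc, ⟨hx.1.conn_lc hx.2.1, by rw [lc_lc]; exact hx.2.1⟩, by simp [hx.2.2]⟩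

theorem cnt_eq_leaf (n : ℕ) : cnt (· = leaf) n = if n = 1 then 1 else 0 := by
  rw [cnt]
  split_ifs with h
  · rw [card_eq_one]
    refine ⟨leaf, ?_⟩
    ext x
    simp only [mem_level, mem_singleton]
    refine ⟨fun h => h.2.1, ?_⟩
    rintro rfl
    exact ⟨.leaf, rfl, by simp [h]⟩
  · rw [card_eq_zero, eq_empty_iff_forall_notMem]
    intro x hx
    rw [mem_level] at hx
    obtain ⟨-, rfl, hx⟩ := hx
    exact h (by simpa using hx.symm)

theorem numConn_eq (n : ℕ) : numConn n = (if n = 1 then 1 else 0) + numDisc n + numPd n := by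
  have h₁ := cnt_add_cnt_not Conn (fun x => Conn (lc x)) n
  have h₂ := cnt_add_cnt_not (fun x => Conn x ∧ Conn (lc x)) (· = leaf) n
  rw [cnt_conn_not_conn_lc] at h₁
  have h₃ : cnt (fun x => (Conn x ∧ Conn (lc x)) ∧ x = leaf) n = cnt (· = leaf) n := by
    refine cnt_congr (fun x _ => ⟨fun h => h.2, ?_⟩) n
    rintro rfl
    rw [lc_leaf]
    exact ⟨⟨conn_leaf, conn_leaf⟩, rfl⟩
  have h₄ : cnt (fun x => (Conn x ∧ Conn (lc x)) ∧ x ≠ leaf) n = numPd n := by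
    refine cnt_congr (fun x hx => ⟨fun h => ?_, fun h => ?_⟩) n
    · exact (hx.eq_leaf_or_isPd h.1.1 h.1.2).resolve_left h.2
    · exact ⟨⟨h.conn, h.lc.conn⟩, fun h' => not_isPd_leaf (h' ▸ h)⟩
  rw [h₃, cnt_eq_leaf] at h₂
  simp only [ne_eq] at h₄
  rw [numConn]
  omega

theorem numAll_eq (n : ℕ) : numAll n = (if n = 1 then 1 else 0) + 2 * numDisc n + numPd n := by
  have := numConn_eq n
  have := numConn_add_numDisc n
  omega

theorem numCore_eq (n : ℕ) : numCore n = (if n = 1 then 1 else 0) + 2 * numDisc n := by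
  have := numAll_eq n
  have := numPd_add_numCore n
  omega

theorem numDisc_one : numDisc 1 = 0 := by
  rw [numDisc, cnt, card_eq_zero, eq_empty_iff_forall_notMem]
  intro x hx
  rw [mem_level] at hx
  obtain ⟨h, hc, hn⟩ := hx
  obtain ⟨a, b, ha, hb, rfl⟩ := h.exists_add hc
  have := ha.size_pos
  have := hb.size_pos
  simp at hn
  omega

theorem numPd_eq (n : ℕ) :
    numPd n = ∑ ij ∈ antidiagonal n, numCore ij.1 * numAll ij.2 := by
  simp only [numCore, numAll, cnt, ← card_product]
  rw [← card_sigma]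
  symm
  refine card_bij (fun x _ => pd x.2.1 x.2.2) ?_ ?_ ?_
  · rintro ⟨⟨i, j⟩, a, b⟩ h
    simp only [mem_sigma, HasAntidiagonal.mem_antidiagonal, mem_product, mem_level] at h ⊢
    obtain ⟨rfl, ⟨ha, -, rfl⟩, hb, -, rfl⟩ := h
    exact ⟨ha.pd hb, ⟨a, b, ha, hb, rfl⟩, size_pd a b⟩
  · rintro ⟨⟨i, j⟩, a, b⟩ h ⟨⟨i', j'⟩, a', b'⟩ h' he
    simp only [mem_sigma, HasAntidiagonal.mem_antidiagonal, mem_product, mem_level] at h h'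
    obtain ⟨rfl, ⟨ha, pa, rfl⟩, hb, -, rfl⟩ := h
    obtain ⟨-, ⟨ha', pa', rfl⟩, hb', -, rfl⟩ := h'
    obtain ⟨rfl, rfl⟩ := pd_inj ha pa ha' pa' he
    rfl
  · intro x hx
    obtain ⟨-, h, rfl⟩ := mem_level.1 hx
    obtain ⟨a, b, ha, pa, hb, rfl⟩ := h.exists_not_isPd
    exact ⟨⟨(size a, size b), a, b⟩, by simp [ha, pa, hb], rfl⟩

theorem numAll_le_numDisc_succ (n : ℕ) : numAll n ≤ numDisc (n + 1) := by
  refine card_le_card_of_injOn (leaf + ·) ?_ ?_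
  · intro x hx
    simp only [mem_coe, mem_level] at hx ⊢
    exact ⟨Good.leaf.add hx.1, Good.leaf.not_conn_add hx.1, by simp [hx.2.2, add_comm]⟩
  · intro x hx y hy h
    simp only [mem_coe, mem_level] at hx hy
    have := congrArg comps h
    simp only [comps_add, add_right_inj] at this
    rw [← hx.1.comps.2, this, hy.1.comps.2]

theorem numAll_mul_le (a b : ℕ) : numAll a * numAll b ≤ numAll (a + b + 1) := by
  have h₁ := numAll_le_numDisc_succ a
  have h₂ := numCore_eq (a + 1)
  have h₃ := numAll_eq (a + b + 1)
  have h₄ : numCore (a + 1) * numAll b ≤ numPd (a + b + 1) := by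
    rw [numPd_eq]
    exact single_le_sum (f := fun ij : ℕ × ℕ => numCore ij.1 * numAll ij.2)
      (fun _ _ => Nat.zero_le _) 
      (a := (a + 1, b)) (HasAntidiagonal.mem_antidiagonal.2 (by dsimp only; ring))
  have h₅ : numAll a * numAll b ≤ numCore (a + 1) * numAll b :=
    Nat.mul_le_mul_right _ (by omega)
  omega

theorem prod_map_pow_size (z : ℝ) (s : Multiset MarkedClass) :
    (s.map fun x => z ^ size x).prod = z ^ size s.sum := by
  induction s using Multiset.induction with
  | empty => simp
  | cons a s ih => simp [ih, pow_add]

theorem comps_injOn : Set.InjOn comps {x | Good x ∨ x = 0} := by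
  have : ∀ x, Good x ∨ x = 0 → (comps x).sum = x := by
    rintro x (h | rfl)
    · exact h.comps.2
    · rw [← Multiset.sum_zero, comps_sum (by simp)]
  intro x hx y hy h
  rw [← this x hx, h, this y hy]

theorem size_lt_of_mem_comps {x p : MarkedClass} (hx : Good x) (hc : ¬ Conn x)
    (hp : p ∈ comps x) : size p < size x := by
  obtain ⟨h₁, h₂⟩ := hx.comps
  obtain ⟨t, ht⟩ := Multiset.exists_cons_of_mem hp
  have h₃ : x = p + t.sum := by rw [← h₂, ht, Multiset.sum_cons]
  have : t ≠ 0 := by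
    rintro rfl
    rw [Multiset.sum_zero, add_zero] at h₃
    exact hc (h₃ ▸ (h₁ p hp).2)
  have := (good_sum (fun q hq => (h₁ q (ht ▸ Multiset.mem_cons_of_mem hq)).1) this).size_pos
  rw [h₃, size_add]
  omega

theorem hasSum_conn {z : ℝ} (h₀ : 0 < z) (h₁ : z < 1) (n : ℕ) :
    HasSum (fun s : {s : Multiset MarkedClass // ∀ a ∈ s, a ∈ upTo Conn n} => z ^ size s.1.sum) (∏ j ∈ range (n + 1), (1 - z ^ j)⁻¹ ^ numConn j) := by
  have := hasSum_multiset (upTo Conn n) (w := fun x => z ^ size x) (fun x => by positivity)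
    (fun x hx => pow_lt_one₀ h₀.le h₁ (mem_upTo.1 hx).1.size_pos.ne')
  simp only [prod_map_pow_size] at this
  rwa [prod_upTo Conn n fun j => (1 - z ^ j)⁻¹] at this

theorem one_add_le_prod {z : ℝ} (h₀ : 0 < z) (h₁ : z < 1) (n : ℕ) :
    1 + ∑ j ∈ range (n + 1), numConn j * z ^ j + ∑ j ∈ range (n + 2), numDisc j * z ^ j ≤
      ∏ j ∈ range (n + 1), (1 - z ^ j)⁻¹ ^ numConn j := by
  classical
  rw [← sum_upTo, ← sum_upTo]
  let T := insert 0 (upTo Conn n ∪ upTo (fun x => ¬ Conn x) (n + 1))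
  have hT : ∀ x ∈ T, x = 0 ∨ Good x ∧ (Conn x ∧ size x ≤ n ∨ ¬ Conn x ∧ size x ≤ n + 1) := by
    intro x hx
    simp only [T, mem_insert, mem_union, mem_upTo] at hx
    tauto
  have h : ∀ x ∈ T, ∀ a ∈ comps x, a ∈ upTo Conn n := by
    intro x hx a ha
    obtain rfl | ⟨hg, hc, hs⟩ | ⟨hg, hc, hs⟩ := by simpa only [and_or_left] using hT x hx
    · rw [← Multiset.sum_zero, comps_sum (by simp)] at ha
      simp at ha
    · rw [comps_of_conn hc, Multiset.mem_singleton] at ha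
      rw [ha, mem_upTo]
      exact ⟨hg, hc, hs⟩
    · have := size_lt_of_mem_comps hg hc ha
      have := hg.comps.1 a ha
      rw [mem_upTo]
      exact ⟨this.1, this.2, by omega⟩
  have hs := sum_le_hasSum (T.attach.image fun x => (⟨comps x.1, h x.1 x.2⟩ :
    {s : Multiset MarkedClass // ∀ a ∈ s, a ∈ upTo Conn n}))
    (fun s _ => by positivity) (hasSum_conn h₀ h₁ n)
  rw [sum_image] at hs
  · have h' : ∀ x : T, z ^ size (comps x.1).sum = z ^ size x.1 := by
      intro x
      obtain hx | ⟨hx, -⟩ := hT x.1 x.2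
      · rw [hx, ← Multiset.sum_zero, comps_sum (by simp)]
      · rw [hx.comps.2]
    simp only [h'] at hs
    rw [sum_attach T fun x => z ^ size x, sum_insert, sum_union] at hs
    · simpa [add_assoc] using hs
    · rw [disjoint_left]
      intro x hx hx'
      exact (mem_upTo.1 hx').2.1 (mem_upTo.1 hx).2.1
    · simp only [mem_union, mem_upTo]
      rintro (h | h) <;> simpa using h.1.size_pos
  · intro x _ y _ hxy
    refine Subtype.ext (comps_injOn ?_ ?_ (congrArg Subtype.val hxy))
    · exact (hT x.1 x.2).symm.imp_left And.left
    · exact (hT y.1 y.2).symm.imp_left And.left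

theorem prod_le_one_add {z : ℝ} (h₀ : 0 < z) (h₁ : z < 1) (n : ℕ) {r : ℝ}
    (hr : ∀ n, ∑ j ∈ range (n + 1), numAll j * z ^ j ≤ r) :
    ∏ j ∈ range (n + 1), (1 - z ^ j)⁻¹ ^ numConn j ≤ 1 + r := by
  classical
  refine hasSum_le_of_sum_le (hasSum_conn h₀ h₁ n) fun T => ?_
  have hi : Set.InjOn (fun s : {s : Multiset MarkedClass // ∀ a ∈ s, a ∈ upTo Conn n} => s.1.sum)
      T := by
    intro s _ t _ h
    have h' := congrArg comps h
    simp only at h'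
    rw [comps_sum fun x hx => (mem_upTo.1 (s.2 x hx)).2.1,
      comps_sum fun x hx => (mem_upTo.1 (t.2 x hx)).2.1] at h'
    exact Subtype.ext h'
  rw [← sum_image (f := fun x => z ^ size x) hi]
  let N := T.sup fun s => size s.1.sum
  calc _ ≤ ∑ x ∈ insert 0 (upTo (fun _ => True) N), z ^ size x := by
        refine sum_le_sum_of_subset_of_nonneg ?_ fun x _ _ => by positivity
        intro x hx
        obtain ⟨s, hs, rfl⟩ := mem_image.1 hx
        rw [mem_insert]
        by_cases h : s.1 = 0
        · simp [h]
        · exact Or.inr (mem_upTo.2 ⟨good_sum (fun x hx => (mem_upTo.1 (s.2 x hx)).1) h, trivial,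
            Finset.le_sup (f := fun s => size s.1.sum) hs⟩)
    _ ≤ 1 + r := by
        rw [sum_insert, sum_upTo]
        · simpa using hr N
        · simp only [mem_upTo]
          intro h
          simpa using h.1.size_pos

theorem numPd_one : numPd 1 = 0 := by
  simp [numPd_eq, Nat.antidiagonal_succ, cnt_zero]

theorem numPd_two : numPd 2 = numCore 1 * numAll 1 := by
  simp [numPd_eq, Nat.antidiagonal_succ, cnt_zero]

theorem numPd_three : numPd 3 = numCore 1 * numAll 2 + numCore 2 * numAll 1 := by
  simp [numPd_eq, Nat.antidiagonal_succ, cnt_zero]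

theorem numPd_four :
    numPd 4 = numCore 1 * numAll 3 + numCore 2 * numAll 2 + numCore 3 * numAll 1 := by
  simp [numPd_eq, Nat.antidiagonal_succ, cnt_zero, add_assoc]

theorem numCore_one : numCore 1 = 1 := by rw [numCore_eq, numDisc_one]; rfl
theorem numAll_one : numAll 1 = 1 := by rw [numAll_eq, numDisc_one, numPd_one]; rfl
theorem numConn_one : numConn 1 = 1 := by rw [numConn_eq, numDisc_one, numPd_one]; rfl

theorem numDisc_two : numDisc 2 = 1 := by
  have h₁ : 1 ≤ numDisc 2 := numAll_one ▸ numAll_le_numDisc_succ 1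
  have h₂ := one_add_le_prod (z := 1 / 1000) (by norm_num) (by norm_num) 1
  simp only [sum_range_succ, prod_range_succ, range_zero, sum_empty, prod_empty, cnt_zero,
    numConn_one, numDisc_one] at h₂
  norm_num at h₂
  have h₃ : (numDisc 2 : ℝ) < 2 := by linarith
  have h₄ : numDisc 2 < 2 := by exact_mod_cast h₃
  omega

theorem numPd_two_eq : numPd 2 = 1 := by rw [numPd_two, numCore_one, numAll_one]
theorem numCore_two : numCore 2 = 2 := by rw [numCore_eq, numDisc_two]; rfl
theorem numAll_two : numAll 2 = 3 := by rw [numAll_eq, numDisc_two, numPd_two_eq]; rfl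
theorem numConn_two : numConn 2 = 2 := by rw [numConn_eq, numDisc_two, numPd_two_eq]; rfl

theorem numDisc_three : numDisc 3 = 3 := by
  have h₁ : 3 ≤ numDisc 3 := numAll_two.symm.trans_le (numAll_le_numDisc_succ 2)
  have h₂ := one_add_le_prod (z := 1 / 1000) (by norm_num) (by norm_num) 2
  simp only [sum_range_succ, prod_range_succ, range_zero, sum_empty, prod_empty, cnt_zero,
    numConn_one, numDisc_one, numConn_two, numDisc_two] at h₂
  norm_num at h₂
  have h₃ : (numDisc 3 : ℝ) < 4 := by linarith
  have h₄ : numDisc 3 < 4 := by exact_mod_cast h₃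
  omega

theorem numPd_three_eq : numPd 3 = 5 := by
  rw [numPd_three, numCore_one, numAll_one, numCore_two, numAll_two]
theorem numCore_three : numCore 3 = 6 := by rw [numCore_eq, numDisc_three]; rfl
theorem numAll_three : numAll 3 = 11 := by rw [numAll_eq, numDisc_three, numPd_three_eq]; rfl
theorem numConn_three : numConn 3 = 8 := by rw [numConn_eq, numDisc_three, numPd_three_eq]; rfl

theorem numDisc_four_le : numDisc 4 ≤ 14 := by
  have h₂ := one_add_le_prod (z := 1 / 1000) (by norm_num) (by norm_num) 3
  simp only [sum_range_succ, prod_range_succ, range_zero, sum_empty, prod_empty, cnt_zero,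
    numConn_one, numDisc_one, numConn_two, numDisc_two, numConn_three, numDisc_three] at h₂
  norm_num at h₂
  have h₃ : (numDisc 4 : ℝ) < 15 := by linarith
  have h₄ : numDisc 4 < 15 := by exact_mod_cast h₃
  omega

theorem numPd_four_eq : numPd 4 = 23 := by
  rw [numPd_four, numCore_one, numAll_one, numCore_two, numAll_two, numCore_three, numAll_three]

theorem numConn_four_le : numConn 4 ≤ 37 := by
  have := numConn_eq 4
  rw [numPd_four_eq] at this
  have := numDisc_four_le
  simp at *
  omega

/-- Partial sums of the generating function of `f`. -/
noncomputable def psum (f : ℕ → ℕ) (z : ℝ) (n : ℕ) : ℝ := ∑ j ∈ range (n + 1), f j * z ^ j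

theorem psum_succ (f : ℕ → ℕ) (z : ℝ) (n : ℕ) :
    psum f z (n + 1) = psum f z n + f (n + 1) * z ^ (n + 1) := sum_range_succ _ _

theorem psum_nonneg (f : ℕ → ℕ) {z : ℝ} (hz : 0 ≤ z) (n : ℕ) : 0 ≤ psum f z n :=
  sum_nonneg fun _ _ => by positivity

theorem psum_one_ite (z : ℝ) {n : ℕ} (hn : 1 ≤ n) :
    psum (fun j => if j = 1 then 1 else 0) z n = z := by
  have : 1 < n + 1 := by omega
  simp [psum, ite_mul, sum_ite_eq', this]

theorem psum_numConn (z : ℝ) {n : ℕ} (hn : 1 ≤ n) :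
    psum numConn z n = z + psum numDisc z n + psum numPd z n := by
  refine Eq.trans ?_ (congrArg (· + psum numDisc z n + psum numPd z n) (psum_one_ite z hn))
  simp only [psum, ← sum_add_distrib]
  refine sum_congr rfl fun j _ => ?_
  rw [numConn_eq]
  push_cast
  ring

theorem psum_numAll (z : ℝ) {n : ℕ} (hn : 1 ≤ n) :
    psum numAll z n = z + 2 * psum numDisc z n + psum numPd z n := by
  refine Eq.trans ?_ (congrArg (· + 2 * psum numDisc z n + psum numPd z n) (psum_one_ite z hn))
  simp only [psum, mul_sum, ← sum_add_distrib]
  refine sum_congr rfl fun j _ => ?_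
  rw [numAll_eq]
  push_cast
  ring

theorem psum_numCore (z : ℝ) {n : ℕ} (hn : 1 ≤ n) :
    psum numCore z n = z + 2 * psum numDisc z n := by
  refine Eq.trans ?_ (congrArg (· + 2 * psum numDisc z n) (psum_one_ite z hn))
  simp only [psum, mul_sum, ← sum_add_distrib]
  refine sum_congr rfl fun j _ => ?_
  rw [numCore_eq]
  push_cast
  ring

theorem psum_numPd_succ_le {z : ℝ} (hz : 0 ≤ z) (n : ℕ) :
    psum numPd z (n + 1) ≤ psum numCore z n * psum numAll z n := by
  classical
  rw [psum, psum, psum, ← sum_upTo, ← sum_upTo, ← sum_upTo, sum_mul_sum, ← sum_product']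
  have hi : Set.InjOn (fun ab : MarkedClass × MarkedClass => pd ab.1 ab.2)
      (upTo (fun x => ¬ IsPd x) n ×ˢ upTo (fun _ => True) n) := by
    rintro ⟨a, b⟩ h ⟨a', b'⟩ h' he
    simp only [Set.mem_prod, mem_coe, mem_upTo] at h h'
    obtain ⟨rfl, rfl⟩ := pd_inj h.1.1 h.1.2.1 h'.1.1 h'.1.2.1 he
    rfl
  have : ∀ ab : MarkedClass × MarkedClass, z ^ size ab.1 * z ^ size ab.2 =
      z ^ size (pd ab.1 ab.2) := fun ab => by rw [size_pd, pow_add]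
  simp only [this]
  rw [← sum_image (f := fun x => z ^ size x) (g := fun ab : MarkedClass × MarkedClass =>
    pd ab.1 ab.2) (by rwa [coe_product])]
  refine sum_le_sum_of_subset_of_nonneg ?_ fun _ _ _ => by positivity
  intro x hx
  obtain ⟨-, h, hn⟩ := mem_upTo.1 hx
  obtain ⟨a, b, ha, pa, hb, rfl⟩ := h.exists_not_isPd
  have := ha.size_pos
  have := hb.size_pos
  rw [size_pd] at hn
  refine mem_image.2 ⟨(a, b), ?_, rfl⟩
  simp only [mem_product, mem_upTo]
  exact ⟨⟨ha, pa, by omega⟩, hb, trivial, by omega⟩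

theorem inv_one_sub_le_exp {w : ℝ} (hw : 0 ≤ w) (h : w ≤ 0.00004999) :
    (1 - w)⁻¹ ≤ Real.exp (40001 / 40000 * w) := by
  refine (?_ : _ ≤ _).trans (Real.quadratic_le_exp_of_nonneg (by positivity))
  rw [inv_le_iff_one_le_mul₀ (by linarith)]
  nlinarith [mul_nonneg hw hw, mul_nonneg hw (sub_nonneg.2 h),
    mul_nonneg (mul_nonneg hw hw) (sub_nonneg.2 h)]

theorem exp_le_inv_one_sub {w : ℝ} (hw : 0.0001 ≤ w) (hw' : w ≤ 1 / 2) :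
    Real.exp (40001 / 40000 * w) ≤ (1 - w)⁻¹ := by
  have h₁ : 1 - 40001 / 80000 * w ≤ Real.exp (-(40001 / 80000 * w)) := by
    have := Real.add_one_le_exp (-(40001 / 80000 * w))
    linarith
  have h₂ : 1 - w ≤ Real.exp (-(40001 / 40000 * w)) := by
    have : Real.exp (-(40001 / 40000 * w)) = Real.exp (-(40001 / 80000 * w)) ^ 2 := by
      rw [← Real.exp_nat_mul]; push_cast; ring_nf
    rw [this]
    refine le_trans ?_ (pow_le_pow_left₀ (by linarith) h₁ 2)
    nlinarith
  rw [Real.exp_neg] at h₂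
  rw [le_inv_comm₀ (Real.exp_pos _) (by linarith)]
  exact h₂

/-- The product from `one_add_le_prod`. -/
noncomputable def eprod (z : ℝ) (n : ℕ) : ℝ :=
  ∏ j ∈ range (n + 1), (1 - z ^ j)⁻¹ ^ numConn j

theorem eprod_succ (z : ℝ) (n : ℕ) :
    eprod z (n + 1) = eprod z n * (1 - z ^ (n + 1))⁻¹ ^ numConn (n + 1) := prod_range_succ _ _

theorem eprod_three (z : ℝ) :
    eprod z 3 = (1 - z)⁻¹ * (1 - z ^ 2)⁻¹ ^ 2 * (1 - z ^ 3)⁻¹ ^ 8 := by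
  simp [eprod, prod_range_succ, cnt_zero, numConn_one, numConn_two, numConn_three]
  ring

theorem psum_numConn_three (z : ℝ) : psum numConn z 3 = z + 2 * z ^ 2 + 8 * z ^ 3 := by
  simp [psum, sum_range_succ, cnt_zero, numConn_one, numConn_two, numConn_three]

theorem psum_numDisc_four_le {z : ℝ} (hz : 0 ≤ z) :
    psum numDisc z 4 ≤ z ^ 2 + 3 * z ^ 3 + 14 * z ^ 4 := by
  have : (numDisc 4 : ℝ) ≤ 14 := by exact_mod_cast numDisc_four_le
  have := mul_le_mul_of_nonneg_right this (pow_nonneg hz 4)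
  simp [psum, sum_range_succ, cnt_zero, numDisc_one, numDisc_two, numDisc_three]
  linarith

theorem psum_numPd_four (z : ℝ) : psum numPd z 4 = z ^ 2 + 5 * z ^ 3 + 23 * z ^ 4 := by
  simp [psum, sum_range_succ, cnt_zero, numPd_one, numPd_two_eq, numPd_three_eq, numPd_four_eq]

theorem eprod_four_le {z : ℝ} (h₀ : 0 ≤ z) (h₁ : z ≤ 1) (hz : 0.0001 ≤ z ^ 4)
    (hz' : z ^ 4 ≤ 1 / 2) :
    eprod z 4 ≤ Real.exp (40001 / 40000 * psum numConn z 4) *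
      (eprod z 3 * (1 - z ^ 4)⁻¹ ^ 37 *
        Real.exp (-(40001 / 40000 * (psum numConn z 3 + 37 * z ^ 4)))) := by
  have h := exp_le_inv_one_sub hz hz'
  rw [eprod_succ z 3, psum_succ _ z 3]
  obtain ⟨q, hq⟩ := Nat.exists_eq_add_of_le numConn_four_le
  have h₂ : 0 ≤ eprod z 3 := prod_nonneg fun j _ =>
      pow_nonneg (inv_nonneg.2 (by linarith [pow_le_one₀ h₀ h₁ (n := j)])) _
  norm_num only
  rw [hq]
  have hs : (37 : ℝ) = numConn 4 + q := by exact_mod_cast hq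
  rw [hs]
  generalize (1 - z ^ 4)⁻¹ = a at *
  have h₃ : Real.exp (40001 / 40000 * (psum numConn z 3 + numConn 4 * z ^ 4)) *
      Real.exp (-(40001 / 40000 * (psum numConn z 3 + (numConn 4 + q) * z ^ 4))) *
      Real.exp (40001 / 40000 * z ^ 4) ^ q = 1 := by
    rw [← Real.exp_nat_mul, ← Real.exp_add, ← Real.exp_add, Real.exp_eq_one_iff]
    ring
  have ha : 0 ≤ a := (Real.exp_pos _).le.trans h
  calc eprod z 3 * a ^ numConn 4 = eprod z 3 * a ^ numConn 4 * 1 := (mul_one _).symm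
    _ ≤ eprod z 3 * a ^ numConn 4 *
      (Real.exp (40001 / 40000 * (psum numConn z 3 + numConn 4 * z ^ 4)) *
      Real.exp (-(40001 / 40000 * (psum numConn z 3 + (numConn 4 + q) * z ^ 4))) * a ^ q) := by
        rw [← h₃]
        gcongr
    _ = _ := by rw [pow_add]; ring

theorem eprod_le {z : ℝ} (h₀ : 0 ≤ z) (h₁ : z ≤ 1) (hz : z ^ 5 ≤ 0.00004999) {E : ℝ}
    (hE : eprod z 4 ≤ Real.exp (40001 / 40000 * psum numConn z 4) * E) {n : ℕ} (hn : 4 ≤ n) :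
    eprod z n ≤ Real.exp (40001 / 40000 * psum numConn z n) * E := by
  induction n, hn using Nat.le_induction with
  | base => exact hE
  | succ n hn ih =>
    have h₂ : z ^ (n + 1) ≤ 0.00004999 := (pow_le_pow_of_le_one h₀ h₁ (by omega)).trans hz
    have h₃ := inv_one_sub_le_exp (pow_nonneg h₀ (n + 1)) h₂
    have h₄ : 0 ≤ (1 - z ^ (n + 1))⁻¹ := inv_nonneg.2 (by linarith)
    rw [eprod_succ, psum_succ, mul_add, Real.exp_add]
    have h₅ : (1 - z ^ (n + 1))⁻¹ ^ numConn (n + 1) ≤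
        Real.exp (40001 / 40000 * (numConn (n + 1) * z ^ (n + 1))) := by
      refine (pow_le_pow_left₀ h₄ h₃ _).trans_eq ?_
      rw [← Real.exp_nat_mul]
      ring_nf
    have h₆ : 0 ≤ eprod z n := prod_nonneg fun j _ =>
      pow_nonneg (inv_nonneg.2 (by linarith [pow_le_one₀ h₀ h₁ (n := j)])) _
    calc _ ≤ eprod z n * Real.exp (40001 / 40000 * (numConn (n + 1) * z ^ (n + 1))) :=
          mul_le_mul_of_nonneg_left h₅ h₆
      _ ≤ _ := mul_le_mul_of_nonneg_right ih (Real.exp_pos _).le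
      _ = _ := by ring

theorem one_add_le_eprod {z : ℝ} (h₀ : 0 < z) (h₁ : z < 1) (n : ℕ) :
    1 + psum numConn z n + psum numDisc z (n + 1) ≤ eprod z n := one_add_le_prod h₀ h₁ n

theorem partial_sums_le {z c s : ℝ} (h₀ : 0 < z) (h₁ : z < 1) (hz₄ : 0.0001 ≤ z ^ 4)
    (hz₄' : z ^ 4 ≤ 1 / 2) (hz₅ : z ^ 5 ≤ 0.00004999)
    (hc : z ^ 2 + 3 * z ^ 3 + 14 * z ^ 4 ≤ c) (hs : z ^ 2 + 5 * z ^ 3 + 23 * z ^ 4 ≤ s)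
    (hs' : (z + 2 * c) * (z + 2 * c + s) ≤ s)
    (hc' : (1 - z)⁻¹ * (1 - z ^ 2)⁻¹ ^ 2 * (1 - z ^ 3)⁻¹ ^ 8 * (1 - z ^ 4)⁻¹ ^ 37 *
      Real.exp (40001 / 40000 * (c + s - 2 * z ^ 2 - 8 * z ^ 3 - 37 * z ^ 4)) ≤ 1 + z + 2 * c + s)
    {n : ℕ} (hn : 4 ≤ n) : psum numDisc z n ≤ c ∧ psum numPd z n ≤ s := by
  induction n, hn using Nat.le_induction with
  | base => exact ⟨(psum_numDisc_four_le h₀.le).trans hc, (psum_numPd_four z).trans_le hs⟩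
  | succ n hn ih =>
    obtain ⟨ih₁, ih₂⟩ := ih
    constructor
    · have h₂ := eprod_le h₀.le h₁.le hz₅ (eprod_four_le h₀.le h₁.le hz₄ hz₄') hn
      rw [eprod_three, psum_numConn_three] at h₂
      generalize (1 - z)⁻¹ * (1 - z ^ 2)⁻¹ ^ 2 * (1 - z ^ 3)⁻¹ ^ 8 * (1 - z ^ 4)⁻¹ ^ 37 = A at *
      have h₃ := one_add_le_eprod h₀ h₁ n
      have h₄ := psum_numConn z (show 1 ≤ n by omega)
      have h₅ := psum_nonneg numConn h₀.le n
      have h₆ := psum_nonneg numDisc h₀.le (n + 1)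
      set y := A * Real.exp (40001 / 40000 *
        (psum numConn z n - z - 2 * z ^ 2 - 8 * z ^ 3 - 37 * z ^ 4)) with hy
      have h₇ : eprod z n ≤ y := by
        refine h₂.trans_eq ?_
        rw [hy, mul_left_comm, ← Real.exp_add]
        ring_nf
      have h₈ := Real.add_one_le_exp (40001 / 40000 * (z + c + s - psum numConn z n))
      have h₉ : y * Real.exp (40001 / 40000 * (z + c + s - psum numConn z n)) ≤
          1 + z + 2 * c + s := by
        refine Eq.trans_le ?_ hc'
        rw [hy, mul_assoc, ← Real.exp_add]
        ring_nf
      have h₁₀ : y * (40001 / 40000 * (z + c + s - psum numConn z n) + 1) ≤ 1 + z + 2 * c + s :=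
        (mul_le_mul_of_nonneg_left h₈ (by linarith)).trans h₉
      nlinarith
    · refine (psum_numPd_succ_le h₀.le n).trans (le_trans ?_ hs')
      rw [psum_numCore z (by omega), psum_numAll z (by omega)]
      have := psum_nonneg numDisc h₀.le n
      have := psum_nonneg numPd h₀.le n
      gcongr; linarith

theorem numAll_le_pow {n : ℕ} (hn : 1 ≤ n) : (numAll n : ℝ) ≤ 7.24999 ^ n := by
  obtain ⟨h₁, h₂⟩ := partial_sums_le (z := 1 / 7.24999) (c := 0.0650039) (s := 0.0980675)
    (by norm_num) (by norm_num) (by norm_num) (by norm_num) (by norm_num) (by norm_num)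
    (by norm_num) (by norm_num) (by
      have h₁ : (1 - 1 / 7.24999 : ℝ)⁻¹ * (1 - (1 / 7.24999) ^ 2)⁻¹ ^ 2 *
          (1 - (1 / 7.24999) ^ 3)⁻¹ ^ 8 * (1 - (1 / 7.24999) ^ 4)⁻¹ ^ 37 ≤ 1.24763812 := by
        norm_num
      have h₂ : 40001 / 40000 * (0.0650039 + 0.0980675 - 2 * (1 / 7.24999) ^ 2 -
          8 * (1 / 7.24999) ^ 3 - 37 * (1 / 7.24999) ^ 4) ≤ (0.090638258 : ℝ) := by
        norm_num
      have h₃ : Real.exp 0.090638258 ≤ 1.0948729 := by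
        refine (Real.exp_bound' (n := 6) (by norm_num) (by norm_num) (by norm_num)).trans ?_
        norm_num [sum_range_succ, Nat.factorial]
      refine (mul_le_mul h₁ ((Real.exp_le_exp.2 h₂).trans h₃) (Real.exp_pos _).le
        (by norm_num)).trans ?_
      norm_num) (show 4 ≤ n + 4 by omega)
  have h₃ := psum_numAll (1 / 7.24999) (show 1 ≤ n + 4 by omega)
  have h₄ : numAll n * (1 / 7.24999 : ℝ) ^ n ≤ psum numAll (1 / 7.24999) (n + 4) :=
    single_le_sum (f := fun j => (numAll j : ℝ) * (1 / 7.24999 : ℝ) ^ j)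
      (fun _ _ => by positivity) (mem_range.2 (by omega))
  have h₅ : numAll n * (1 / 7.24999 : ℝ) ^ n ≤ 1 := by
    refine h₄.trans ?_
    rw [h₃]
    linarith
  rwa [one_div, inv_pow, ← div_eq_mul_inv, div_le_one (by positivity)] at h₅

theorem eprod_three_mul_exp_le {z : ℝ} (h₀ : 0 ≤ z) (h₁ : z < 1) {n : ℕ} (hn : 3 ≤ n) :
    eprod z 3 * Real.exp (psum numConn z n - psum numConn z 3) ≤ eprod z n := by
  induction n, hn using Nat.le_induction with
  | base => simp
  | succ n hn ih =>
    rw [eprod_succ z n, psum_succ _ z n, add_sub_right_comm, Real.exp_add, ← mul_assoc]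
    have h₂ : z ^ (n + 1) < 1 := pow_lt_one₀ h₀ h₁ (by omega)
    have h₃ : Real.exp (numConn (n + 1) * z ^ (n + 1)) ≤
        (1 - z ^ (n + 1))⁻¹ ^ numConn (n + 1) := by
      rw [Real.exp_nat_mul]
      refine pow_le_pow_left₀ (Real.exp_pos _).le ?_ _
      rw [le_inv_comm₀ (Real.exp_pos _) (by linarith), ← Real.exp_neg]
      linarith [Real.add_one_le_exp (-z ^ (n + 1))]
    have h₆ : 0 ≤ eprod z n := prod_nonneg fun j _ =>
      pow_nonneg (inv_nonneg.2 (by linarith [pow_le_one₀ h₀ h₁.le (n := j)])) _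
    exact mul_le_mul ih h₃ (Real.exp_pos _).le h₆

theorem tendsto_psum {f : ℕ → ℕ} {z : ℝ} (h : Summable fun j => (f j : ℝ) * z ^ j) :
    Tendsto (psum f z) atTop (𝓝 (∑' j, (f j : ℝ) * z ^ j)) :=
  h.hasSum.tendsto_sum_nat.comp (tendsto_add_atTop_nat 1)

theorem exists_limits {z : ℝ} (h₀ : 0 < z) (h₁ : z < 1)
    (h : Summable fun j => (numAll j : ℝ) * z ^ j) :
    ∃ c s : ℝ, 0 ≤ c ∧ 0 ≤ s ∧ s = (z + 2 * c) * (z + 2 * c + s) ∧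
      eprod z 3 * Real.exp (z + c + s - psum numConn z 3) ≤ 1 + (z + 2 * c + s) := by
  have hle : ∀ f : ℕ → ℕ, (∀ n, f n ≤ numAll n) → Summable fun j => (f j : ℝ) * z ^ j :=
    fun f hf => h.of_nonneg_of_le (fun _ => by positivity) fun n => by
      have : (f n : ℝ) ≤ numAll n := by exact_mod_cast hf n
      gcongr
  have hd := hle numDisc fun n => by have := numConn_add_numDisc n; omega
  have hp := hle numPd fun n => by have := numPd_add_numCore n; omega
  have hu := hle numCore fun n => by have := numPd_add_numCore n; omega
  have hc := hle numConn fun n => by have := numConn_add_numDisc n; omega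
  have ev := eventually_ge_atTop 1
  have e₁ : ∑' j, (numAll j : ℝ) * z ^ j = z + 2 * ∑' j, (numDisc j : ℝ) * z ^ j +
      ∑' j, (numPd j : ℝ) * z ^ j :=
    tendsto_nhds_unique (tendsto_psum h) (((tendsto_psum hd).const_mul 2 |>.const_add z |>.add
      (tendsto_psum hp)).congr' (ev.mono fun n hn => (psum_numAll z hn).symm))
  have e₂ : ∑' j, (numCore j : ℝ) * z ^ j = z + 2 * ∑' j, (numDisc j : ℝ) * z ^ j :=
    tendsto_nhds_unique (tendsto_psum hu) (((tendsto_psum hd).const_mul 2 |>.const_add z).congr'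
      (ev.mono fun n hn => (psum_numCore z hn).symm))
  have e₃ : ∑' j, (numConn j : ℝ) * z ^ j = z + ∑' j, (numDisc j : ℝ) * z ^ j +
      ∑' j, (numPd j : ℝ) * z ^ j :=
    tendsto_nhds_unique (tendsto_psum hc) (((tendsto_psum hd).const_add z |>.add
      (tendsto_psum hp)).congr' (ev.mono fun n hn => (psum_numConn z hn).symm))
  have e₄ : ∑' j, (numPd j : ℝ) * z ^ j =
      (∑' j, (numCore j : ℝ) * z ^ j) * ∑' j, (numAll j : ℝ) * z ^ j := by
    rw [tsum_mul_tsum_eq_tsum_sum_antidiagonal_of_summable_norm hu.norm h.norm]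
    refine tsum_congr fun n => ?_
    rw [numPd_eq, Nat.cast_sum, sum_mul]
    refine sum_congr rfl fun ij hij => ?_
    rw [← HasAntidiagonal.mem_antidiagonal.1 hij, pow_add]
    push_cast
    ring
  refine ⟨∑' j, (numDisc j : ℝ) * z ^ j, ∑' j, (numPd j : ℝ) * z ^ j,
    tsum_nonneg fun _ => by positivity, tsum_nonneg fun _ => by positivity, ?_, ?_⟩
  · rw [← e₁, e₄, e₂]
  · rw [← e₁, ← e₃]
    refine le_of_tendsto ((Real.continuous_exp.tendsto _ |>.comp
      ((tendsto_psum hc).sub_const _)).const_mul _) (eventually_atTop.2 ⟨3, fun n hn => ?_⟩)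
    refine (eprod_three_mul_exp_le h₀.le h₁ hn).trans (prod_le_one_add h₀ h₁ n fun n => ?_)
    exact h.sum_le_tsum _ fun _ _ => by positivity

theorem not_summable : ¬ Summable fun j => (numAll j : ℝ) * (1 / 7.2492) ^ j := by
  intro h
  obtain ⟨c, s, hc, hs, hcs, hE⟩ := exists_limits (by norm_num) (by norm_num) h
  rw [eprod_three, psum_numConn_three] at hE
  have h₁ : 1.23107824 ≤ (1 - 1 / 7.2492 : ℝ)⁻¹ * (1 - (1 / 7.2492) ^ 2)⁻¹ ^ 2 *
      (1 - (1 / 7.2492) ^ 3)⁻¹ ^ 8 := by norm_num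
  have h₂ : 1.1096218 ≤ Real.exp (0.3010239 -
      (1 / 7.2492 + 2 * (1 / 7.2492) ^ 2 + 8 * (1 / 7.2492) ^ 3)) := by
    refine le_trans ?_ (Real.sum_le_exp_of_nonneg (by norm_num) 7)
    norm_num [sum_range_succ, Nat.factorial]
  generalize (1 - 1 / 7.2492 : ℝ)⁻¹ * (1 - (1 / 7.2492) ^ 2)⁻¹ ^ 2 *
      (1 - (1 / 7.2492) ^ 3)⁻¹ ^ 8 = A at *
  have h₃ := Real.add_one_le_exp (1 / 7.2492 + c + s - 0.3010239)
  have h₄ : 1.366030 * (1 / 7.2492 + c + s - 0.3010239 + 1) ≤ 1 + (1 / 7.2492 + 2 * c + s) := by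
    refine le_trans (le_trans ?_ (mul_le_mul (mul_le_mul h₁ h₂ (by norm_num) (by linarith)) h₃
      (by linarith) (mul_nonneg (by linarith) (Real.exp_pos _).le))) (Eq.trans_le ?_ hE)
    · have : 0 ≤ 1 / 7.2492 + c + s - 0.3010239 + 1 := by linarith
      exact mul_le_mul_of_nonneg_right (by norm_num) this
    · rw [mul_assoc, ← Real.exp_add]
      ring_nf
  obtain ⟨t, ht⟩ : ∃ t, t = 1 - (1 / 7.2492 + 2 * c) := ⟨_, rfl⟩
  have h₅ : (1 + (1 / 7.2492 + 2 * c + s)) * t = 1 := by rw [ht]; linarith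
  have h₆ : 0 < t := pos_of_mul_pos_right (h₅ ▸ one_pos) (by positivity)
  have h₇ := mul_le_mul_of_nonneg_right h₄ h₆.le
  have h₈ : c = (1 - 1 / 7.2492 - t) / 2 := by linarith
  rw [h₅, h₈] at h₇
  rw [h₈] at h₅
  nlinarith [sq_nonneg (t - 0.73205)]

theorem exists_lt_numAll : ∃ a, (7.2491 : ℝ) ^ (a + 1) < numAll a := by
  by_contra! h
  refine not_summable (Summable.of_nonneg_of_le (fun _ => by positivity) (fun n => ?_)
    ((summable_geometric_of_lt_one (r := 7.2491 / 7.2492) (by norm_num) (by norm_num)).mul_left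
      7.2491))
  calc (numAll n : ℝ) * (1 / 7.2492) ^ n ≤ 7.2491 ^ (n + 1) * (1 / 7.2492) ^ n := by
        gcongr
        exact h n
    _ = _ := by rw [pow_succ, div_pow, div_pow, one_pow]; ring

theorem one_le_numAll {n : ℕ} (hn : 1 ≤ n) : 1 ≤ numAll n := by
  induction n, hn using Nat.le_induction with
  | base => exact numAll_one.ge
  | succ n hn ih =>
    have := numAll_le_numDisc_succ n
    have := numAll_eq (n + 1)
    omega

theorem exists_mul_pow_le_numAll :
    ∃ c : ℝ, 0 < c ∧ ∀ n, 1 ≤ n → c * 7.2491 ^ n ≤ numAll n := by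
  obtain ⟨a, ha⟩ := exists_lt_numAll
  refine ⟨(7.2491 ^ (a + 1))⁻¹, by positivity, fun n => ?_⟩
  induction n using Nat.strong_induction_on with
  | _ n ih =>
    intro hn
    by_cases h : n ≤ a + 1
    · have h₁ : (1 : ℝ) ≤ numAll n := by exact_mod_cast one_le_numAll hn
      refine le_trans ?_ h₁
      rw [inv_mul_le_one₀ (by positivity)]
      exact pow_le_pow_right₀ (by norm_num) h
    · obtain ⟨k, rfl⟩ : ∃ k, n = a + k + 1 := ⟨n - a - 1, by omega⟩
      have h₁ : (numAll a : ℝ) * numAll k ≤ numAll (a + k + 1) := by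
        exact_mod_cast numAll_mul_le a k
      refine le_trans ?_ h₁
      calc _ = (7.2491 : ℝ) ^ (a + 1) * ((7.2491 ^ (a + 1))⁻¹ * 7.2491 ^ k) := by
            rw [show a + k + 1 = (a + 1) + k by ring, pow_add]; ring
        _ ≤ _ := mul_le_mul ha.le (ih k (by omega) (by omega)) (by positivity) (by positivity)

end MarkedClass

end

section Steps

/-- `Steps G S n u v`: there is a walk inside `S` from `u` to `v` with `n` steps, each of which
follows an edge or stays put. -/
inductive Steps {V : Type} (G : SimpleGraph V) (S : Set V) : ℕ → V → V → Prop
  | refl {u : V} (hu : u ∈ S) : Steps G S 0 u u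
  | step {n : ℕ} {u v w : V} (h : Steps G S n u v) (hw : w ∈ S) (hvw : v = w ∨ G.Adj v w) :
      Steps G S (n + 1) u w

variable {V W : Type} {G : SimpleGraph V} {S T : Set V} {u v w : V} {m n : ℕ}

namespace Steps

theorem right_mem (h : Steps G S n u v) : v ∈ S := by cases h <;> assumption

theorem trans (h : Steps G S m u v) (k : Steps G S n v w) : Steps G S (m + n) u w := by
  induction k with
  | refl => exact h
  | step _ hw hvw ih => exact (ih h).step hw hvw

theorem single (hu : u ∈ S) (hv : v ∈ S) (h : u = v ∨ G.Adj u v) : Steps G S 1 u v :=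
  (refl hu).step hv h

theorem symm (h : Steps G S n u v) : Steps G S n v u := by
  induction h with
  | refl hu => exact refl hu
  | step h hw hvw ih =>
    rw [Nat.add_comm]
    exact (single hw h.right_mem (hvw.imp Eq.symm SimpleGraph.Adj.symm)).trans ih

theorem mono (h : Steps G S m u v) (hmn : m ≤ n) : Steps G S n u v := by
  induction n, hmn using Nat.le_induction with
  | base => exact h
  | succ n _ ih => exact ih.step h.right_mem (Or.inl rfl)

theorem map {H : SimpleGraph W} {T : Set W} (f : V → W)
    (hf : ∀ u v, G.Adj u v → f u = f v ∨ H.Adj (f u) (f v)) (hT : ∀ u ∈ S, f u ∈ T)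
    (h : Steps G S n u v) : Steps H T n (f u) (f v) := by
  induction h with
  | refl hu => exact refl (hT _ hu)
  | step _ hw hvw ih =>
    refine ih.step (hT _ hw) ?_
    rcases hvw with rfl | hvw
    · exact Or.inl rfl
    · exact hf _ _ hvw

theorem subset (h : Steps G S n u v) (hST : S ⊆ T) : Steps G T n u v :=
  h.map id (fun _ _ => Or.inr) hST

theorem eq_of_zero (h : Steps G S 0 u v) : u = v := by cases h; rfl

theorem of_one (h : Steps G S 1 u v) : u = v ∨ G.Adj u v := by
  cases h with
  | step h _ hvw => rw [h.eq_of_zero]; exact hvw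

theorem exists_adj (h : Steps G S n u v) : u = v ∨ ∃ x ∈ S, G.Adj x v := by
  induction h with
  | refl => exact Or.inl rfl
  | step h _ hvw ih =>
    rcases hvw with rfl | hvw
    · exact ih
    · exact Or.inr ⟨_, h.right_mem, hvw⟩

theorem exists_of_pendant (h : Steps G S n u v) (x : V) (hx : ∀ y, G.Adj y v → y = x) :
    u = v ∨ ∃ m, n = m + 1 ∧ Steps G S m u x := by
  induction h with
  | refl => exact Or.inl rfl
  | step h _ hvw ih =>
    rcases hvw with rfl | hvw
    · obtain h' | ⟨m, rfl, h'⟩ := ih hx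
      · exact Or.inl h'
      · exact Or.inr ⟨_, rfl, h'.mono (Nat.le_succ m)⟩
    · exact Or.inr ⟨_, rfl, hx _ hvw ▸ h⟩

theorem of_walk {u v : S} (p : (G.induce S).Walk u v) : Steps G S p.length u v := by
  induction p with
  | nil => exact refl (Subtype.prop _)
  | cons h p ih =>
    rw [SimpleGraph.Walk.length_cons, Nat.add_comm]
    exact (single (Subtype.prop _) (Subtype.prop _) (Or.inr h)).trans ih

theorem exists_walk (h : Steps G S n u v) :
    ∃ (hu : u ∈ S) (hv : v ∈ S) (p : (G.induce S).Walk ⟨u, hu⟩ ⟨v, hv⟩), p.length ≤ n := by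
  induction h with
  | refl hu => exact ⟨hu, hu, .nil, le_rfl⟩
  | step h hw hvw ih =>
    obtain ⟨hu, hv, p, hp⟩ := ih
    rcases hvw with rfl | hvw
    · exact ⟨hu, hw, p, by omega⟩
    · have : (G.induce S).Adj ⟨_, hv⟩ ⟨_, hw⟩ := hvw
      exact ⟨hu, hw, p.concat this, by simpa using hp⟩

end Steps

/-- Any two vertices of `S` are joined by a walk inside `S`. -/
def Linked (G : SimpleGraph V) (S : Set V) : Prop := ∀ u ∈ S, ∀ v ∈ S, ∃ n, Steps G S n u v

/-- Distances do not grow in connected induced subgraphs. -/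
def Hereditary (G : SimpleGraph V) : Prop :=
  ∀ S, Linked G S → ∀ u ∈ S, ∀ v ∈ S, ∀ n, Steps G Set.univ n u v → Steps G S n u v

theorem linked_iff (hS : S.Nonempty) : Linked G S ↔ (G.induce S).Connected := by
  constructor
  · intro h
    have := hS.to_subtype
    refine ⟨fun u v => ?_⟩
    obtain ⟨n, hn⟩ := h u u.2 v v.2
    obtain ⟨_, _, p, -⟩ := hn.exists_walk
    exact p.reachable
  · intro h u hu v hv
    obtain ⟨p⟩ := h.preconnected ⟨u, hu⟩ ⟨v, hv⟩
    exact ⟨_, Steps.of_walk p⟩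

theorem steps_iff_dist (h : (G.induce S).Connected) {u v : S} :
    Steps G S n u v ↔ (G.induce S).dist u v ≤ n := by
  constructor
  · intro h
    obtain ⟨_, _, p, hp⟩ := h.exists_walk
    exact (SimpleGraph.dist_le p).trans hp
  · intro h'
    obtain ⟨p, hp⟩ := h.exists_walk_length_eq_dist u v
    exact (Steps.of_walk p).mono (hp.trans_le h')

theorem steps_univ_iff_dist (h : G.Connected) {u v : V} :
    Steps G Set.univ n u v ↔ G.dist u v ≤ n := by
  constructor
  · intro h
    obtain ⟨_, _, p, hp⟩ := h.exists_walk
    refine (SimpleGraph.dist_le (p.map (SimpleGraph.Embedding.induce Set.univ).toHom)).trans ?_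
    rwa [SimpleGraph.Walk.length_map]
  · intro h'
    obtain ⟨p, hp⟩ := h.exists_walk_length_eq_dist u v
    refine Steps.mono ?_ (hp.trans_le h')
    clear hp h'
    induction p with
    | nil => exact .refl trivial
    | cons h p ih =>
      rw [SimpleGraph.Walk.length_cons, Nat.add_comm]
      exact (Steps.single (S := Set.univ) trivial trivial (Or.inr h)).trans ih

theorem hereditary_iff (h : G.Connected) : Hereditary G ↔ DistanceHereditary G := by
  constructor
  · intro hG S hS u v
    have hl := (linked_iff (Set.nonempty_coe_sort.1 hS.nonempty)).2 hS
    refine le_antisymm ?_ ?_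
    · rw [← steps_iff_dist hS]
      exact hG S hl u u.2 v v.2 _ ((steps_univ_iff_dist h).2 le_rfl)
    · rw [← steps_univ_iff_dist h]
      exact ((steps_iff_dist hS).2 le_rfl).subset (Set.subset_univ S)
  · intro hG S hS u hu v hv n hn
    have hc := (linked_iff ⟨u, hu⟩).1 hS
    have := hG S hc ⟨u, hu⟩ ⟨v, hv⟩
    refine (steps_iff_dist hc (u := ⟨u, hu⟩) (v := ⟨v, hv⟩)).2 ?_
    rw [this]
    exact (steps_univ_iff_dist h).1 hn

theorem Hereditary.of_embedding {H : SimpleGraph W} (hH : Hereditary H) (f : V ↪ W)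
    (hf : ∀ u v, H.Adj (f u) (f v) ↔ G.Adj u v) : Hereditary G := by
  have key : ∀ (S : Set V) n a b, Steps H (f '' S) n a b →
      ∀ u v, f u = a → f v = b → Steps G S n u v := by
    intro S n a b h
    induction h with
    | refl hu =>
      intro u v hu' hv'
      obtain rfl := f.injective (hu'.trans hv'.symm)
      obtain ⟨x, hx, rfl⟩ := hu
      rw [f.injective hu']
      exact .refl hx
    | step h hw hvw ih =>
      intro u v hu' hv'
      obtain ⟨y, hy, hy'⟩ := h.right_mem
      obtain ⟨x, hx, hx'⟩ := hw
      obtain rfl := f.injective (hx'.trans hv'.symm)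
      refine (ih u y hu' hy').step hx ?_
      rw [← hy', ← hx', hf] at hvw
      exact hvw.imp (fun h => f.injective h) id
  intro S hS u hu v hv n hn
  refine key S n _ _ (hH (f '' S) ?_ (f u) ⟨u, hu, rfl⟩ (f v) ⟨v, hv, rfl⟩ n ?_) u v rfl rfl
  · rintro _ ⟨a, ha, rfl⟩ _ ⟨b, hb, rfl⟩
    obtain ⟨n, hn⟩ := hS a ha b hb
    exact ⟨n, hn.map f (fun u v h => Or.inr ((hf u v).2 h)) fun u hu => ⟨u, hu, rfl⟩⟩
  · exact hn.map f (fun u v h => Or.inr ((hf u v).2 h)) fun _ _ => trivial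

/-- Attach a new vertex which is adjacent to `v` if `e`, and to the neighbours of `v` if `t`. -/
def SimpleGraph.attach (G : SimpleGraph V) (v : V) (t e : Prop) : SimpleGraph (Option V) where
  Adj
    | none, none => False
    | none, some w => (w = v ∧ e) ∨ (t ∧ G.Adj v w)
    | some w, none => (w = v ∧ e) ∨ (t ∧ G.Adj v w)
    | some u, some w => G.Adj u w
  symm := ⟨by rintro (_ | u) (_ | w) h; exacts [h, h, h, h.symm]⟩
  loopless := ⟨by rintro (_ | u) h; exacts [h, G.irrefl h]⟩

section
variable {t e : Prop}
@[simp] theorem attach_none_some : (G.attach v t e).Adj none (some w) ↔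
    (w = v ∧ e) ∨ (t ∧ G.Adj v w) := Iff.rfl
@[simp] theorem attach_some_none : (G.attach v t e).Adj (some w) none ↔
    (w = v ∧ e) ∨ (t ∧ G.Adj v w) := Iff.rfl
@[simp] theorem attach_some_some : (G.attach v t e).Adj (some u) (some w) ↔ G.Adj u w := Iff.rfl

theorem Hereditary.attach (hG : Hereditary G) (v : V) (hte : t ∨ e) :
    Hereditary (G.attach v t e) := by
  classical
  intro S hS
  have hρ : ∀ a b, (G.attach v t e).Adj a b → a.getD v = b.getD v ∨ G.Adj (a.getD v) (b.getD v) := by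
    rintro (_ | a) (_ | b) h
    · exact Or.inl rfl
    · exact h.imp (fun h => h.1.symm) And.right
    · exact h.imp And.left fun h => h.2.symm
    · exact Or.inr h
  set T : Set V := (fun a => a.getD v) '' S with hT
  have hTl : Linked G T := by
    rintro _ ⟨a, ha, rfl⟩ _ ⟨b, hb, rfl⟩
    obtain ⟨n, hn⟩ := hS a ha b hb
    exact ⟨n, hn.map _ hρ fun u hu => ⟨u, hu, rfl⟩⟩
  have hd : ∀ a ∈ S, ∀ b ∈ S, ∀ n, Steps (G.attach v t e) Set.univ n a b →
      Steps G T n (a.getD v) (b.getD v) := fun a ha b hb n h =>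
    hG T hTl _ ⟨a, ha, rfl⟩ _ ⟨b, hb, rfl⟩ n (h.map _ hρ fun _ _ => trivial)
  have hσ : t → ∀ a b, G.Adj a b → (if a = v then none else some a) =
      (if b = v then none else some b) ∨ (G.attach v t e).Adj (if a = v then none else some a)
      (if b = v then none else some b) := by
    intro ht a b h
    split_ifs with ha hb hb
    · exact Or.inl rfl
    · exact Or.inr (Or.inr ⟨ht, ha ▸ h⟩)
    · exact Or.inr (Or.inr ⟨ht, hb ▸ h.symm⟩)
    · exact Or.inr h
  by_cases hn : none ∈ S
  swap
  · have hT' : ∀ a ∈ T, some a ∈ S := by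
      rintro _ ⟨_ | a, ha, rfl⟩
      · exact (hn ha).elim
      · exact ha
    rintro (_ | a) ha (_ | b) hb n h
    · exact (hn ha).elim
    · exact (hn ha).elim
    · exact (hn hb).elim
    · exact (hd _ ha _ hb n h).map some (fun _ _ => Or.inr) hT'
  by_cases hv : some v ∈ S
  · have hT' : ∀ a ∈ T, some a ∈ S := by
      rintro _ ⟨_ | a, ha, rfl⟩
      · exact hv
      · exact ha
    have key : ∀ w, some w ∈ S → ∀ n, Steps (G.attach v t e) Set.univ n (some w) none →
        Steps (G.attach v t e) S n (some w) none := by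
      intro w hw n h
      by_cases ht : t
      · by_cases hwv : w = v
        · subst hwv
          by_cases he : e
          · refine (Steps.single hw hn (Or.inr (Or.inl ⟨rfl, he⟩))).mono ?_
            rcases n with _ | n
            · exact absurd h.eq_of_zero (by simp)
            · omega
          · obtain ⟨m, hm⟩ := hS _ hw _ hn
            obtain h' | ⟨x, hx, hxn⟩ := hm.exists_adj
            · simp at h'
            · obtain _ | x := x
              · exact hxn.elim
              · refine ((Steps.single hw hx (Or.inr ?_)).step hn (Or.inr hxn)).mono ?_
                · obtain h' | h' := hxn
                  · exact (he h'.2).elim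
                  · exact h'.2
                · rcases n with _ | _ | n
                  · exact absurd h.eq_of_zero (by simp)
                  · obtain h' | h' := h.of_one
                    · simp at h'
                    · simp [he] at h'
                  · omega
        · have := (hd _ hw _ hn n h).map (fun a => if a = v then none else some a) (hσ ht)
            (T := S) fun a ha => by
              split_ifs
              · exact hn
              · exact hT' a ha
          simpa [hwv] using this
      · have he := hte.resolve_left ht
        obtain h' | ⟨m, rfl, h'⟩ := h.exists_of_pendant (some v) (by
          rintro (_ | y) hy
          · exact hy.elim
          · simp [ht] at hy
            exact congrArg some hy.1)
        · simp at h'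
        · exact ((hd _ hw _ hv m h').map some (fun _ _ => Or.inr) hT').step hn
            (Or.inr (Or.inl ⟨rfl, he⟩))
    rintro (_ | a) ha (_ | b) hb n h
    · exact (Steps.refl hn).mono (Nat.zero_le n)
    · exact (key b hb n h.symm).symm
    · exact key a ha n h
    · exact (hd _ ha _ hb n h).map some (fun _ _ => Or.inr) hT'
  · by_cases ht : t
    · intro a ha b hb n h
      have hab : ∀ a ∈ S, (if a.getD v = v then none else some (a.getD v)) = a := by
        rintro (_ | a) ha
        · simp
        · have : a ≠ v := by rintro rfl; exact hv ha
          simp [this]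
      have := (hd _ ha _ hb n h).map (fun a => if a = v then none else some a) (hσ ht)
            (T := S) (by
              rintro _ ⟨a, ha, rfl⟩
              dsimp only
              rw [hab a ha]
              exact ha)
      simpa only [hab a ha, hab b hb] using this
    · have : ∀ a ∈ S, a = none := by
        intro a ha
        obtain ⟨m, hm⟩ := hS a ha none hn
        obtain h' | ⟨x, hx, hxn⟩ := hm.exists_adj
        · exact h'
        · obtain _ | x := x
          · exact hxn.elim
          · simp [ht] at hxn
            exact (hv (hxn.1 ▸ hx)).elim
      intro a ha b hb n h
      rw [this a ha, this b hb]
      exact (Steps.refl hn).mono (Nat.zero_le n)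
end

end Steps

namespace Marked

variable {V W : Type}

/-- Attach a new vertex below `v`; it is marked if it inherits a mark of `v`. -/
def ext (X : Marked V) (v : V) (t e : Prop) : Marked (Option V) where
  G := X.G.attach v t e
  M
    | none => t ∧ X.M v
    | some w => X.M w

/-- Add a root vertex adjacent to the marked vertices. -/
def cone (X : Marked V) : SimpleGraph (Option V) where
  Adj
    | none, none => False
    | none, some w => X.M w
    | some w, none => X.M w
    | some u, some w => X.G.Adj u w
  symm := ⟨by rintro (_ | u) (_ | w) h; exacts [h, h, h, h.symm]⟩
  loopless := ⟨by rintro (_ | u) h; exacts [h, X.G.irrefl h]⟩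

section
variable {X : Marked V} {u v w : V} {t e : Prop}

@[simp] theorem ext_G : (X.ext v t e).G = X.G.attach v t e := rfl
@[simp] theorem ext_M_none : (X.ext v t e).M none ↔ t ∧ X.M v := Iff.rfl
@[simp] theorem ext_M_some : (X.ext v t e).M (some w) ↔ X.M w := Iff.rfl
@[simp] theorem cone_none_some : X.cone.Adj none (some w) ↔ X.M w := Iff.rfl
@[simp] theorem cone_some_none : X.cone.Adj (some w) none ↔ X.M w := Iff.rfl
@[simp] theorem cone_some_some : X.cone.Adj (some u) (some w) ↔ X.G.Adj u w := Iff.rfl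
end

theorem op_ext (cr mk : Prop) (X : Marked V) (Y : Marked W) (v : V) (t e : Prop) :
    Iso (op cr mk (X.ext v t e) Y) ((op cr mk X Y).ext (.inl v) t e) := by
  refine ⟨⟨fun | .inl none => none | .inl (some a) => some (.inl a) | .inr b => some (.inr b),
    fun | none => .inl none | some (.inl a) => .inl (some a) | some (.inr b) => .inr b,
    by rintro ((_ | a) | b) <;> rfl, by rintro (_ | a | b) <;> rfl⟩, ?_, ?_⟩
  · rintro ((_ | a) | a) ((_ | b) | b) <;> simp <;> tauto
  · rintro ((_ | a) | a) <;> simp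

theorem op_leaf_ext (Y : Marked W) (v : W) (t e : Prop) :
    Iso (op True False leaf (Y.ext v t e)) ((op True False leaf Y).ext (.inr v) t e) := by
  refine ⟨⟨fun | .inr none => none | .inr (some a) => some (.inr a) | .inl b => some (.inl b),
    fun | none => .inr none | some (.inr a) => .inr (some a) | some (.inl b) => .inl b,
    by rintro (b | (_ | a)) <;> rfl, by rintro (_ | a | b) <;> rfl⟩, ?_, ?_⟩
  · rintro (a | (_ | a)) (b | (_ | b)) <;> simp [leaf]
  · rintro (a | (_ | a)) <;> simp

theorem lc_ext (X : Marked V) (v : V) (t e : Prop) :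
    Iso (lc (X.ext v t e)) ((lc X).ext v t ((t ∧ X.M v) ↔ ¬ e)) := by
  refine ⟨Equiv.refl _, ?_, ?_⟩
  · have h (w : V) : (X.ext v t e).lc.G.Adj none (some w) ↔
        ((lc X).ext v t ((t ∧ X.M v) ↔ ¬ e)).G.Adj none (some w) := by
      by_cases hw : w = v
      · subst hw
        simp [lc_adj]
      · simp [lc_adj, hw, Ne.symm hw]
        tauto
    rintro (_ | a) (_ | b)
    · simp
    · exact (h b).symm
    · rw [SimpleGraph.adj_comm, SimpleGraph.adj_comm (X.ext v t e).lc.G]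
      exact (h a).symm
    · simp [lc_adj]
  · rintro (_ | a) <;> simp

theorem op_leaf_leaf_true : Iso (op False True leaf leaf) (leaf.ext () True False) := by
  refine ⟨⟨fun | .inl _ => none | .inr _ => some (), fun | none => .inl () | some _ => .inr (),
    by rintro (a | b) <;> rfl, by rintro (_ | a) <;> rfl⟩, ?_, ?_⟩
  · rintro (a | a) (b | b) <;> simp [leaf]
  · rintro (a | a) <;> simp [leaf]

theorem op_leaf_leaf_false : Iso (op True False leaf leaf) (leaf.ext () False True) := by
  refine ⟨⟨fun | .inl _ => some () | .inr _ => none, fun | none => .inr () | some _ => .inl (),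
    by rintro (a | b) <;> rfl, by rintro (_ | a) <;> rfl⟩, ?_, ?_⟩
  · rintro (a | a) (b | b) <;> simp [leaf]
  · rintro (a | a) <;> simp [leaf]

/-- An isomorphism between marked graphs extends to their cones. -/
theorem Iso.cone {X : Marked V} {Y : Marked W} (h : Iso X Y) : Nonempty (X.cone ≃g Y.cone) := by
  obtain ⟨e, h₁, h₂⟩ := h
  refine ⟨⟨e.optionCongr, ?_⟩⟩
  rintro (_ | a) (_ | b) <;> simp [h₁, h₂]

theorem cone_ext (X : Marked V) (v : V) (t e : Prop) :
    Nonempty (X.cone.attach (some v) t e ≃g (X.ext v t e).cone) := by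
  let f : Option (Option V) → Option (Option V) := fun
    | none => some none
    | some none => none
    | some (some a) => some (some a)
  have hf : f.Involutive := by rintro (_ | _ | a) <;> rfl
  have hf₀ : f none = some none := rfl
  have hf₁ : f (some none) = none := rfl
  have hf₂ (a : V) : f (some (some a)) = some (some a) := rfl
  refine ⟨⟨hf.toPerm, ?_⟩⟩
  rintro (_ | _ | a) (_ | _ | b) <;> simp [hf₀, hf₁, hf₂]

theorem hereditary_cone_leaf : Hereditary leaf.cone := by
  have h : Hereditary (⊥ : SimpleGraph Unit) := fun S _ u hu v _ n _ =>
    (Steps.refl hu).mono (Nat.zero_le n)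
  refine (h.attach () (t := False) (e := True) (Or.inr trivial)).of_embedding
    (Function.Embedding.refl _) ?_
  rintro (_ | a) (_ | b) <;> simp [leaf]

theorem Hit.connected_cone {X : Marked V} (h : X.Hit) : X.cone.Connected := by
  have key : ∀ v, X.cone.Reachable none (some v) := by
    by_contra! hc
    obtain ⟨w, hw⟩ := hc
    obtain ⟨v, hv, hm⟩ := h {v | ¬ X.cone.Reachable none (some v)}
      (fun u v hu huv hv => hu (hv.trans
        (SimpleGraph.Adj.reachable (cone_some_some.2 huv.symm)))) ⟨w, hw⟩
    exact hv (SimpleGraph.Adj.reachable (cone_none_some.2 hm))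
  have key' : ∀ v, X.cone.Reachable none v := by
    rintro (_ | v)
    exacts [.refl _, key v]
  exact ⟨fun u v => (key' u).symm.trans (key' v)⟩

end Marked

theorem Hereditary.of_iso {V W : Type} {G : SimpleGraph V} {H : SimpleGraph W}
    (hG : Hereditary G) (e : G ≃g H) : Hereditary H :=
  hG.of_embedding e.symm.toEquiv.toEmbedding fun _ _ => e.symm.map_adj_iff

namespace MarkedClass
open Marked

/-- The classes obtained from a good class by attaching a vertex. -/
def IsExt (x : MarkedClass) : Prop :=
  ∃ (V : Type) (_ : Finite V) (X : Marked V) (v : V) (t e : Prop),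
    Good X.cls ∧ (t ∨ e) ∧ x = (X.ext v t e).cls

theorem IsExt.op {x y : MarkedClass} (hx : IsExt x) (cr mk : Prop)
    (h : ∀ z, Good z → Good (op cr mk z y)) : IsExt (op cr mk x y) := by
  obtain ⟨V, _, X, v, t, e, hX, hte, rfl⟩ := hx
  induction y using ind with | _ W Y
  exact ⟨_, inferInstance, _, _, t, e, h _ hX, hte, cls_eq_iff.2 (op_ext _ _ X Y v t e)⟩

theorem Good.eq_leaf_or_isExt {x : MarkedClass} (h : Good x) :
    x = MarkedClass.leaf ∨ IsExt x := by
  induction h with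
  | leaf => exact Or.inl rfl
  | lc h ih =>
    obtain rfl | ⟨V, _, X, v, t, e, hX, hte, rfl⟩ := ih
    · exact Or.inl lc_leaf
    · refine Or.inr ⟨V, _, X.lc, v, t, _, hX.lc, ?_, cls_eq_iff.2 (lc_ext X v t e)⟩
      tauto
  | @add x y hx hy ihx ihy =>
    right
    obtain rfl | ihx := ihx
    · obtain rfl | ihy := ihy
      · exact ⟨_, inferInstance, Marked.leaf, (), True, False, .leaf, Or.inl trivial,
          cls_eq_iff.2 op_leaf_leaf_true⟩
      · rw [add_comm]
        exact ihy.op False True fun z hz => hz.add hx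
    · exact ihx.op False True fun z hz => hz.add hy
  | @pd x y hx hy ihx ihy =>
    right
    obtain rfl | ihx := ihx
    · obtain rfl | ⟨W, _, Y, v, t, e, hY, hte, rfl⟩ := ihy
      · exact ⟨_, inferInstance, Marked.leaf, (), False, True, .leaf, Or.inr trivial,
          cls_eq_iff.2 op_leaf_leaf_false⟩
      · exact ⟨_, inferInstance, _, _, t, e, hx.pd hY, hte, cls_eq_iff.2 (op_leaf_ext Y v t e)⟩
    · exact ihx.op True False fun z hz => hz.pd hy

theorem Good.hereditary_cone {V : Type} [Finite V] {X : Marked V} (h : Good X.cls) :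
    Hereditary X.cone := by
  induction hn : Nat.card V using Nat.strong_induction_on generalizing V with
  | _ n ih =>
    subst hn
    obtain hx | ⟨W, _, Y, w, t, e, hY, hte, hx⟩ := h.eq_leaf_or_isExt
    · obtain ⟨f⟩ := (cls_eq_iff.1 hx).symm.cone
      exact hereditary_cone_leaf.of_iso f
    · obtain ⟨f⟩ := (cls_eq_iff.1 hx).symm.cone
      have hs := congrArg size hx
      rw [size_cls, size_cls, Finite.card_option] at hs
      obtain ⟨g⟩ := cone_ext Y w t e
      exact (((ih _ (by omega) hY rfl).attach (some w) hte).of_iso g).of_iso f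

theorem Good.connected_cone {V : Type} [Finite V] {X : Marked V} (h : Good X.cls) :
    X.cone.Connected := Marked.Hit.connected_cone h.hit

end MarkedClass

section Split

variable {V : Type} {R : V → V → Prop} {A B : Set V}

/-- `B` is a nonempty proper subset of `A` which is not related to the rest of `A`. -/
structure Splits (R : V → V → Prop) (A B : Set V) : Prop where
  subset : B ⊆ A
  nonempty : B.Nonempty
  diff_nonempty : (A \ B).Nonempty
  not_rel : ∀ b ∈ B, ∀ c ∈ A, c ∉ B → ¬ R b c

/-- The relation `R` has no induced path on four points of `A`. -/
def PathFree (R : V → V → Prop) (A : Set V) : Prop :=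
  ∀ a ∈ A, ∀ b ∈ A, ∀ c ∈ A, ∀ d ∈ A, R a b → R b c → R c d → R a c ∨ R b d ∨ R a d

theorem Splits.of_not_rel_mem (hR : ∀ a b, R a b → R b a) {x y : V}
    (hP : PathFree R (insert x A)) (hx : x ∉ A) (hB : Splits R A B) (hy : y ∈ B)
    (hxy : ¬ R x y) : ∃ B', Splits R (insert x A) B' := by
  by_cases hw : ∃ w ∈ A, w ∉ B ∧ R x w
  · obtain ⟨w, hwA, hwB, hxw⟩ := hw
    refine ⟨{u | u ∈ B ∧ ¬ R x u}, fun u hu => Or.inr (hB.subset hu.1), ⟨y, hy, hxy⟩,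
      ⟨x, Or.inl rfl, fun h => hx (hB.subset h.1)⟩, ?_⟩
    rintro u ⟨hu, hxu⟩ v (rfl | hvA) hv huv
    · exact hxu (hR _ _ huv)
    · by_cases hvB : v ∈ B
      · have hxv : R x v := by
          by_contra h
          exact hv ⟨hvB, h⟩
        obtain h | h | h := hP u (Or.inr (hB.subset hu)) v (Or.inr hvA) x (Or.inl rfl) w
          (Or.inr hwA) huv (hR _ _ hxv) hxw
        · exact hxu (hR _ _ h)
        · exact hB.not_rel v hvB w hwA hwB h
        · exact hB.not_rel u hu w hwA hwB h
      · exact hB.not_rel u hu v hvA hvB huv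
  · push Not at hw
    obtain ⟨c, hcA, hcB⟩ := hB.diff_nonempty
    refine ⟨A \ B, fun u hu => Or.inr hu.1, ⟨c, hcA, hcB⟩, ⟨x, Or.inl rfl, fun h => hx h.1⟩, ?_⟩
    rintro u ⟨huA, huB⟩ v (rfl | hvA) hv huv
    · exact hw u huA huB (hR _ _ huv)
    · have hvB : v ∈ B := by
        by_contra h
        exact hv ⟨hvA, h⟩
      exact hB.not_rel v hvB u huA huB (hR _ _ huv)

theorem Splits.compl (hR : ∀ a b, R a b → R b a) (hB : Splits R A B) : Splits R A (A \ B) where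
  subset := Set.sdiff_subset
  nonempty := hB.diff_nonempty
  diff_nonempty := by
    rw [Set.sdiff_sdiff_cancel_left hB.subset]
    exact hB.nonempty
  not_rel b hb c hc hcB h := hB.not_rel c (by
    by_contra h
    exact hcB ⟨hc, h⟩) b hb.1 hb.2 (hR _ _ h)

theorem Splits.insert (hR : ∀ a b, R a b → R b a) {x : V} (hP : PathFree R (insert x A))
    (hx : x ∉ A) (hB : Splits R A B) :
    ∃ B', Splits R (insert x A) B' ∨ Splits (fun a b => ¬ R a b) (insert x A) B' := by
  by_cases h : ∃ y ∈ A, ¬ R x y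
  · obtain ⟨y, hy, hxy⟩ := h
    by_cases hyB : y ∈ B
    · exact (hB.of_not_rel_mem hR hP hx hyB hxy).imp fun _ => Or.inl
    · exact ((hB.compl hR).of_not_rel_mem hR hP hx ⟨hy, hyB⟩ hxy).imp fun _ => Or.inl
  · push Not at h
    obtain ⟨b, hb⟩ := hB.nonempty
    refine ⟨{x}, Or.inr ⟨by simp, by simp, ⟨b, Or.inr (hB.subset hb), ?_⟩, ?_⟩⟩
    · rintro rfl
      exact hx (hB.subset hb)
    · rintro _ rfl c (rfl | hc) hcx
      · exact (hcx rfl).elim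
      · simpa using h c hc

theorem PathFree.not (hP : PathFree R A) (hR : ∀ a b, R a b → R b a) :
    PathFree (fun a b => ¬ R a b) A := by
  intro a ha b hb c hc d hd hab hbc hcd
  by_contra! h
  obtain ⟨hac, hbd, had⟩ := h
  obtain h | h | h := hP c hc a ha d hd b hb (hR _ _ hac) had (hR _ _ hbd)
  · exact hcd h
  · exact hab h
  · exact hbc (hR _ _ h)

theorem PathFree.exists_splits (hA : A.Finite) (hA' : A.Nontrivial) (hP : PathFree R A)
    (hR : ∀ a b, R a b → R b a) :
    ∃ B, Splits R A B ∨ Splits (fun a b => ¬ R a b) A B := by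
  induction A, hA using Set.Finite.induction_on with
  | empty => simp at hA'
  | @insert x A hx _ ih =>
    have hP' : PathFree R A := fun a ha b hb c hc d hd =>
      hP a (Or.inr ha) b (Or.inr hb) c (Or.inr hc) d (Or.inr hd)
    by_cases h : A.Nontrivial
    · obtain ⟨B, hB | hB⟩ := ih h hP'
      · exact hB.insert hR hP hx
      · obtain ⟨B', hB' | hB'⟩ := hB.insert (fun a b h h' => h (hR _ _ h')) (hP.not hR) hx
        · exact ⟨B', Or.inr hB'⟩
        · exact ⟨B', Or.inl (by simpa using hB')⟩
    · rw [Set.not_nontrivial_iff] at h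
      obtain ⟨y, hy, hyx⟩ := hA'.exists_ne x
      have hyA := Set.mem_of_mem_insert_of_ne hy hyx
      have key : ∀ R' : V → V → Prop, ¬ R' x y → Splits R' (insert x A) {x} := by
        refine fun R' hR' => ⟨by simp, by simp, ⟨y, hy, hyx⟩, ?_⟩
        rintro _ rfl c (rfl | hc) hcx
        · exact (hcx rfl).elim
        · rwa [h hc hyA]
      by_cases hxy : R x y
      · exact ⟨_, Or.inr (key _ (not_not.2 hxy))⟩
      · exact ⟨_, Or.inl (key _ hxy)⟩

end Split

namespace Marked

variable {V W : Type} {X : Marked V}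

/-- Every unmarked vertex `v` carries a set `β v` of marked vertices, constant on connected sets of
unmarked vertices, such that `v` is adjacent to no marked vertex or precisely to `β v`; these sets
are modules among the marked vertices, and they form a laminar family. -/
structure Layered (X : Marked V) (β : V → Set V) : Prop where
  marked : ∀ v, ∀ a ∈ β v, X.M a
  eq_of_adj : ∀ u v, ¬ X.M u → ¬ X.M v → X.G.Adj u v → β u = β v
  mem_of_adj : ∀ v a, ¬ X.M v → X.M a → X.G.Adj v a → a ∈ β v
  adj_of_mem : ∀ v a b, ¬ X.M v → X.M a → X.G.Adj v a → b ∈ β v → X.G.Adj v b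
  laminar : ∀ u v, ¬ X.M u → ¬ X.M v → ∀ a ∈ β u, a ∈ β v → β u ⊆ β v ∨ β v ⊆ β u
  module : ∀ v a b c, a ∈ β v → b ∈ β v → X.M c → c ∉ β v → X.G.Adj a c → X.G.Adj b c

variable {β : V → Set V}

theorem Layered.lc (h : X.Layered β) : X.lc.Layered β where
  marked := h.marked
  eq_of_adj u v hu hv huv := h.eq_of_adj u v hu hv ((lc_adj_of_not (X := X) hu).1 huv)
  mem_of_adj v a hv ha hva := h.mem_of_adj v a hv ha ((lc_adj_of_not (X := X) hv).1 hva)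
  adj_of_mem v a b hv ha hva hb :=
    (lc_adj_of_not (X := X) hv).2 (h.adj_of_mem v a b hv ha ((lc_adj_of_not (X := X) hv).1 hva) hb)
  laminar := h.laminar
  module v a b c ha hb hc hcv hac := by
    have hbc : b ≠ c := by
      rintro rfl
      exact hcv hb
    have := h.module v b a c hb ha hc hcv
    have h₁ := h.marked v a ha
    have h₂ := h.marked v b hb
    rw [lc_adj] at hac ⊢
    tauto

theorem Layered.exists_closed (h : X.Layered β) {P : Set V}
    (hP : Splits X.G.Adj {a | X.M a} P)
    (hβ : ∀ v, ¬ X.M v → ∀ a ∈ β v, a ∈ P → β v ⊆ P) :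
    ∃ D, X.Closed D ∧ D.Nonempty ∧ D ≠ Set.univ := by
  obtain ⟨a, ha⟩ := hP.nonempty
  obtain ⟨b, hb, hbP⟩ := hP.diff_nonempty
  refine ⟨{v | v ∈ P ∨ ¬ X.M v ∧ β v ⊆ P}, ?_, ⟨a, Or.inl ha⟩, fun hD => ?_⟩
  · rintro u v (hu | ⟨hu, hu'⟩) huv <;> by_cases hv : X.M v
    · by_contra hc
      exact hP.not_rel u hu v hv (fun h => hc (Or.inl h)) huv
    · exact Or.inr ⟨hv, hβ v hv u (h.mem_of_adj v u hv (hP.subset hu) huv.symm) hu⟩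
    · exact Or.inl (hu' (h.mem_of_adj u v hu hv huv))
    · exact Or.inr ⟨hv, h.eq_of_adj u v hu hv huv ▸ hu'⟩
  · obtain h | h := (hD ▸ Set.mem_univ b : b ∈ {v | v ∈ P ∨ ¬ X.M v ∧ β v ⊆ P})
    · exact hbP h
    · exact h.1 hb

theorem Layered.exists_closed_or_hang [Finite V] (h : X.Layered β) {B : Set V}
    (hB : Splits X.G.Adj {a | X.M a} B) :
    (∃ D, X.Closed D ∧ D.Nonempty ∧ D ≠ Set.univ) ∨ ∃ D, X.Hang D ∧ D.Nonempty := by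
  by_cases hβ : ∀ v, ¬ X.M v → ∀ a ∈ β v, a ∈ B → β v ⊆ B
  · exact Or.inl (h.exists_closed hB hβ)
  set C : Set V := {v | ¬ X.M v ∧ (∃ a ∈ β v, a ∈ B) ∧ ∃ b ∈ β v, b ∉ B}
  have hC : C.Nonempty := by
    push Not at hβ
    obtain ⟨v, hv, a, ha, haB, hv'⟩ := hβ
    obtain ⟨b, hb, hbB⟩ := Set.not_subset.1 hv'
    exact ⟨v, hv, ⟨a, ha, haB⟩, b, hb, hbB⟩
  obtain ⟨v, ⟨hv, ⟨a, ha, haB⟩, b, hb, hbB⟩, hmax⟩ :=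
    Set.exists_max_image C (fun v => (β v).ncard) C.toFinite hC
  by_cases hA : ∀ a, X.M a → a ∈ β v
  · refine Or.inr ⟨{w | ¬ X.M w ∧ β w = β v}, ⟨fun w hw => hw.1, ?_, ?_⟩, v, hv, rfl⟩
    · exact fun u w hu huw hw => ⟨hw, (h.eq_of_adj u w hu.1 hw huw) ▸ hu.2⟩
    · exact fun w hw a b ha hb hwa => h.adj_of_mem w a b hw.1 ha hwa (hw.2 ▸ hA b hb)
  · push Not at hA
    obtain ⟨c, hc, hcv⟩ := hA
    refine Or.inl (h.exists_closed (P := β v) ⟨h.marked v, ⟨a, ha⟩, ⟨c, hc, hcv⟩, ?_⟩ ?_)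
    · intro u hu w hw hwv huw
      by_cases hwB : w ∈ B
      · exact hB.not_rel w hwB b (h.marked v b hb) hbB (h.module v u b w hu hb hw hwv huw).symm
      · exact hB.not_rel a haB w hw hwB (h.module v u a w hu ha hw hwv huw)
    · intro w hw u huw huv
      obtain h' | h' := h.laminar w v hw hv u huw huv
      · exact h'
      · have := hmax w ⟨hw, ⟨a, h' ha, haB⟩, b, h' hb, hbB⟩
        exact (Set.eq_of_subset_of_ncard_le h' this).ge

end Marked

theorem Hereditary.exists_common {V : Type} {G : SimpleGraph V} (hG : Hereditary G) {S : Set V}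
    (hS : Linked G S) {u w x : V} (hu : u ∈ S) (hw : w ∈ S) (hux : G.Adj u x) (hxw : G.Adj x w) :
    u = w ∨ G.Adj u w ∨ ∃ y ∈ S, G.Adj u y ∧ G.Adj y w := by
  have := hG S hS u hu w hw 2
    (((Steps.refl (S := Set.univ) trivial).step trivial (Or.inr hux)).step trivial (Or.inr hxw))
  cases this with
  | step h _ hyw =>
    rcases h.of_one with rfl | huy <;> rcases hyw with rfl | hyw
    · exact Or.inl rfl
    · exact Or.inr (Or.inl hyw)
    · exact Or.inr (Or.inl huy)
    · exact Or.inr (Or.inr ⟨_, h.right_mem, huy, hyw⟩)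

theorem Linked.of_center {V : Type} {G : SimpleGraph V} {S : Set V} (c : V)
    (h : ∀ u ∈ S, ∃ n, Steps G S n c u) : Linked G S := by
  intro u hu v hv
  obtain ⟨m, hm⟩ := h u hu
  obtain ⟨n, hn⟩ := h v hv
  exact ⟨_, hm.symm.trans hn⟩

theorem Steps.reach {V : Type} {G : SimpleGraph V} {S : Set V} {n : ℕ} {u v : V}
    (h : Steps G S n u v) : Steps G {w | ∃ m, Steps G S m u w} n u v := by
  induction h with
  | refl hu => exact .refl ⟨0, .refl hu⟩
  | step h hw hvw ih => exact ih.step ⟨_, h.step hw hvw⟩ hvw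

namespace Marked

variable {V W : Type} {X : Marked V}

/-- The marked vertices adjacent to the component of `v` among the unmarked vertices. -/
def layer (X : Marked V) (v : V) : Set V :=
  {a | X.M a ∧ ∃ n w, Steps X.G {u | ¬ X.M u} n v w ∧ X.G.Adj w a}

theorem layer_eq_of_steps {v w : V} {n : ℕ} (h : Steps X.G {u | ¬ X.M u} n v w) :
    X.layer v = X.layer w := by
  ext a
  refine and_congr_right fun _ => ⟨?_, ?_⟩
  · rintro ⟨m, x, hx, hxa⟩
    exact ⟨_, x, h.symm.trans hx, hxa⟩
  · rintro ⟨m, x, hx, hxa⟩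
    exact ⟨_, x, h.trans hx, hxa⟩

theorem mem_layer {v a : V} (hv : ¬ X.M v) (ha : X.M a) (h : X.G.Adj v a) : a ∈ X.layer v :=
  ⟨ha, 0, v, .refl hv, h⟩

theorem linked_of_root {S : Set (Option V)} (hr : none ∈ S)
    (h : ∀ u, some u ∈ S → X.M u ∨ ∃ a, some a ∈ S ∧ X.M a ∧ X.G.Adj a u) :
    Linked X.cone S := by
  refine .of_center none ?_
  rintro (_ | u) hu
  · exact ⟨0, .refl hr⟩
  · obtain h | ⟨a, ha, hm, hau⟩ := h u hu
    · exact ⟨_, .single hr hu (Or.inr h)⟩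
    · exact ⟨_, (Steps.single hr ha (Or.inr hm)).step hu (Or.inr hau)⟩

theorem adj_of_mem_layer (h : Hereditary X.cone) {v a b : V} (hv : ¬ X.M v) (ha : X.M a)
    (hva : X.G.Adj v a) (hb : b ∈ X.layer v) : X.G.Adj v b := by
  obtain ⟨hbm, n, w, hw, hwb⟩ := hb
  set C : Set V := {w | ∃ m, Steps X.G {u | ¬ X.M u} m v w}
  have hC : ∀ u ∈ C, ¬ X.M u := fun u ⟨m, hm⟩ => hm.right_mem
  set S : Set (Option V) := {x | x = none ∨ x = some b ∨ ∃ u ∈ C, x = some u}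
  have hCS : ∀ u ∈ C, some u ∈ S := fun u hu => Or.inr (Or.inr ⟨u, hu, rfl⟩)
  have hv' : v ∈ C := ⟨0, .refl hv⟩
  have hsteps : ∀ u ∈ C, ∃ m, Steps X.cone S m (some v) (some u) := fun u ⟨m, hm⟩ =>
    ⟨m, hm.reach.map some (fun _ _ => Or.inr) hCS⟩
  have hbS : some b ∈ S := Or.inr (Or.inl rfl)
  obtain ⟨m, hm⟩ := hsteps w ⟨n, hw⟩
  have hmb := hm.step hbS (Or.inr hwb)
  have hl : Linked X.cone S := by
    refine .of_center (some v) ?_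
    rintro _ (rfl | rfl | ⟨u, hu, rfl⟩)
    · exact ⟨_, hmb.step (Or.inl rfl) (Or.inr hbm)⟩
    · exact ⟨_, hmb⟩
    · exact hsteps u hu
  obtain h | h | ⟨y, rfl | rfl | ⟨u, hu, rfl⟩, hy, hy'⟩ := h.exists_common hl (u := none)
    (w := some v) (x := some a) (Or.inl rfl) (hCS v hv') ha hva.symm
  · simp at h
  · exact (hv h).elim
  · exact hy.elim
  · exact hy'.symm
  · exact (hC u hu hy).elim

theorem layered_layer (h : Hereditary X.cone) : X.Layered X.layer where
  marked v a ha := ha.1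
  eq_of_adj u v hu hv huv := layer_eq_of_steps (.single hu hv (Or.inr huv))
  mem_of_adj v a := mem_layer
  adj_of_mem v a b := adj_of_mem_layer h
  laminar u v hu hv c hcu hcv := by
    by_contra! hc
    obtain ⟨a, hau, hav⟩ := Set.not_subset.1 hc.1
    obtain ⟨b, hbv, hbu⟩ := Set.not_subset.1 hc.2
    obtain ⟨hcm, m, w, hw, hwc⟩ := hcu
    obtain ⟨-, n, x, hx, hxc⟩ := hcv
    have hwm : ¬ X.M w := hw.right_mem
    have hxm : ¬ X.M x := hx.right_mem
    rw [layer_eq_of_steps hw] at hau hbu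
    rw [layer_eq_of_steps hx] at hav hbv
    have hwa := adj_of_mem_layer h hwm hcm hwc hau
    have hxb := adj_of_mem_layer h hxm hcm hxc hbv
    have hne : X.layer w ≠ X.layer x := fun h => hav (h ▸ hau)
    obtain h | h | ⟨y, rfl | rfl | rfl | rfl | rfl, hy, hy'⟩ := h.exists_common
      (S := {y | y = none ∨ y = some w ∨ y = some x ∨ y = some a ∨ y = some b})
      (u := some w) (w := some x) (x := some c) (linked_of_root (Or.inl rfl) (by
        rintro z (hz | hz | hz | hz | hz)
        · simp at hz
        · obtain rfl := Option.some.inj hz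
          exact Or.inr ⟨a, by simp, hau.1, hwa.symm⟩
        · obtain rfl := Option.some.inj hz
          exact Or.inr ⟨b, by simp, hbv.1, hxb.symm⟩
        · obtain rfl := Option.some.inj hz
          exact Or.inl hau.1
        · obtain rfl := Option.some.inj hz
          exact Or.inl hbv.1)) (by simp) (by simp) hwc hxc.symm
    · exact hne (congrArg _ (Option.some.inj h))
    · exact hne (layer_eq_of_steps (.single hwm hxm (Or.inr h)))
    · exact hwm hy
    · exact X.cone.irrefl hy
    · exact X.cone.irrefl hy'
    · exact hav (mem_layer hxm hau.1 hy'.symm)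
    · exact hbu (mem_layer hwm hbv.1 hy)
  module v a b c ha hb hc hcv hac := by
    obtain ⟨ham, n, w, hw, hwa⟩ := ha
    have hwm : ¬ X.M w := hw.right_mem
    rw [layer_eq_of_steps hw] at hb hcv
    have hwb := adj_of_mem_layer h hwm ham hwa hb
    obtain h | h | ⟨y, rfl | rfl | rfl | rfl, hy, hy'⟩ := h.exists_common
      (S := {y | y = none ∨ y = some c ∨ y = some b ∨ y = some w})
      (u := some c) (w := some w) (x := some a) (linked_of_root (Or.inl rfl) (by
        rintro z (hz | hz | hz | hz)
        · simp at hz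
        · obtain rfl := Option.some.inj hz
          exact Or.inl hc
        · obtain rfl := Option.some.inj hz
          exact Or.inl hb.1
        · obtain rfl := Option.some.inj hz
          exact Or.inr ⟨b, by simp, hb.1, hwb.symm⟩)) (by simp) (by simp) hac.symm hwa.symm
    · obtain rfl := Option.some.inj h
      exact (hwm hc).elim
    · exact (hcv (mem_layer hwm hc h.symm)).elim
    · exact (hwm hy').elim
    · exact (X.cone.irrefl hy).elim
    · exact hy.symm
    · exact (X.cone.irrefl hy').elim

theorem pathFree_marked (h : Hereditary X.cone) : PathFree X.G.Adj {a | X.M a} := by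
  intro a ha b hb c hc d hd hab hbc hcd
  have hl : Linked X.cone {y | y = some a ∨ y = some b ∨ y = some c ∨ y = some d} := by
    have hs : Steps X.cone {y | y = some a ∨ y = some b ∨ y = some c ∨ y = some d} 0 (some a)
      (some a) := .refl (Or.inl rfl)
    have hs₁ := hs.step (w := some b) (by simp) (Or.inr hab)
    have hs₂ := hs₁.step (w := some c) (by simp) (Or.inr hbc)
    have hs₃ := hs₂.step (w := some d) (by simp) (Or.inr hcd)
    refine .of_center (some a) ?_
    rintro _ (rfl | rfl | rfl | rfl)
    exacts [⟨_, hs⟩, ⟨_, hs₁⟩, ⟨_, hs₂⟩, ⟨_, hs₃⟩]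
  obtain h | h | ⟨y, rfl | rfl | rfl | rfl, hy, hy'⟩ := h.exists_common hl
    (u := some a) (w := some d) (x := none) (by simp) (by simp) ha hd
  · obtain rfl := Option.some.inj h
    exact Or.inl hcd.symm
  · exact Or.inr (Or.inr h)
  · exact (X.cone.irrefl hy).elim
  · exact Or.inr (Or.inl hy')
  · exact Or.inl hy
  · exact (X.cone.irrefl hy').elim

theorem iso_op_restrict {D : Set V} {Y : Marked ↥Dᶜ} {cr mk : Prop}
    (h₁ : ∀ v w, Y.G.Adj v w ↔ X.G.Adj v w)
    (h₂ : ∀ v ∈ D, ∀ w, X.G.Adj v w.1 ↔ cr ∧ X.M v ∧ Y.M w)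
    (h₃ : ∀ w, X.M w.1 ↔ mk ∧ Y.M w) : Iso X (op cr mk (X.restrict D) Y) := by
  classical
  refine Iso.symm ⟨Equiv.Set.sumCompl D, ?_, ?_⟩
  · rintro (a | a) (b | b)
    · simp [restrict]
    · simpa [restrict] using h₂ a a.2 b
    · simpa [restrict, X.G.adj_comm] using h₂ b b.2 a
    · simpa using (h₁ a b).symm
  · rintro (a | a)
    · simp [restrict]
    · simpa using h₃ a

theorem Hit.of_subtype (hX : X.Hit) {D : Set V} {Y : Marked D}
    (h₁ : ∀ v w, X.G.Adj v.1 w.1 → Y.G.Adj v w)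
    (h₂ : ∀ v w, X.G.Adj v.1 w → ¬ Y.M v → w ∈ D) (h₃ : ∀ v, X.M v.1 → Y.M v) : Y.Hit := by
  intro E hE hne
  by_contra! hc
  have hc' : ∀ v ∈ E, ¬ Y.M v := hc
  obtain ⟨_, ⟨v, hv, rfl⟩, hm⟩ := hX (Subtype.val '' E) (by
    rintro _ v ⟨u, hu, rfl⟩ huv
    have hv := h₂ u v huv (hc' u hu)
    exact ⟨⟨v, hv⟩, hE u _ hu (h₁ u ⟨v, hv⟩ huv), rfl⟩) (hne.image _)
  exact hc' v hv (h₃ v hm)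

theorem hereditary_restrict (h : Hereditary X.cone) (D : Set V) :
    Hereditary (X.restrict D).cone := by
  refine h.of_embedding (Function.Embedding.subtype (· ∈ D)).optionMap ?_
  rintro (_ | a) (_ | b) <;> simp [restrict]

end Marked

namespace MarkedClass
open Marked

theorem Good.op {x y : MarkedClass} (hx : Good x) (hy : Good y) (cr : Prop) :
    Good (op cr True x y) := by
  by_cases h : cr
  · have := (hx.lc.add hy.lc).lc
    rw [lc_add, lc_lc, lc_lc] at this
    simpa [h] using this
  · have := hx.add hy
    rw [add_eq] at this
    simpa [h] using this

theorem good_of_subsingleton {V : Type} [Finite V] [Nonempty V] [Subsingleton V] {X : Marked V}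
    (hX : X.Hit) : Good X.cls := by
  obtain ⟨a, ha⟩ := hX.exists_marked
  have : X.cls = MarkedClass.leaf := by
    refine cls_eq_iff.2 ⟨⟨fun _ => (), fun _ => a, fun b => Subsingleton.elim _ _, fun _ => rfl⟩,
      fun u v => ?_, fun u => ?_⟩
    · simp [Marked.leaf, Subsingleton.elim u v]
    · simpa [Marked.leaf, Subsingleton.elim u a] using ha
  exact this ▸ .leaf

theorem good_of_hereditary {V : Type} [Finite V] [Nonempty V] {X : Marked V} (hX : X.Hit)
    (h : Hereditary X.cone) : Good X.cls := by
  induction hn : Nat.card V using Nat.strong_induction_on generalizing V with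
  | _ n ih =>
  subst hn
  have hcard : ∀ {D : Set V}, D ≠ Set.univ → Nat.card D < Nat.card V := fun {D} hD =>
    (Set.ncard_lt_ncard (Set.ssubset_univ_iff.2 hD)).trans_eq (Set.ncard_univ V)
  obtain hs | hs := subsingleton_or_nontrivial V
  · exact good_of_subsingleton hX
  obtain ⟨a, ha⟩ := hX.exists_marked
  have key : (∃ (cr : Prop) (D : Set V), (∀ u ∈ D, ∀ v ∉ D, X.G.Adj u v ↔ cr ∧ X.M u ∧ X.M v) ∧
      D.Nonempty ∧ D ≠ Set.univ) ∨ ∃ D, X.Hang D ∧ D.Nonempty := by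
    by_cases hA : {a | X.M a}.Nontrivial
    · obtain ⟨B, hB | hB⟩ := (pathFree_marked h).exists_splits (Set.toFinite _) hA
        fun _ _ => SimpleGraph.Adj.symm
      · obtain ⟨D, hD, hD'⟩ | hD := (layered_layer h).exists_closed_or_hang hB
        · refine Or.inl ⟨False, D, fun u hu v hv => ?_, hD'⟩
          simpa using fun huv => hv (hD u v hu huv)
        · exact Or.inr hD
      · have hB' : Splits X.lc.G.Adj {a | X.lc.M a} B :=
          ⟨hB.subset, hB.nonempty, hB.diff_nonempty, fun b hb c hc hcB => by
            have := hB.not_rel b hb c hc hcB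
            have hbm : X.M b := hB.subset hb
            have hcm : X.M c := hc
            rw [lc_adj]
            tauto⟩
        obtain ⟨D, hD, hD'⟩ | ⟨D, hD, hD'⟩ := (layered_layer h).lc.exists_closed_or_hang hB'
        · refine Or.inl ⟨True, D, fun u hu v hv => ?_, hD'⟩
          have h₁ := fun huv => hv (hD u v hu huv)
          have h₂ : u ≠ v := by
            rintro rfl
            exact hv hu
          rw [lc_adj] at h₁
          tauto
        · exact Or.inr ⟨D, Marked.lc_lc X ▸ hD.lc, hD'⟩
    · obtain ⟨b, hb⟩ := exists_ne a
      rw [Set.not_nontrivial_iff] at hA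
      refine Or.inr ⟨{v | ¬ X.M v}, ⟨fun _ => id, fun _ _ _ _ => id, ?_⟩, b, fun h => hb (hA h ha)⟩
      intro w _ c d hc hd hwc
      rwa [← hA hc hd]
  obtain ⟨cr, D, hD, hne, huniv⟩ | ⟨D, hD, hne⟩ := key
  · have := hne.to_subtype
    have := (Set.nonempty_compl.2 huniv).to_subtype
    have huniv' : Dᶜ ≠ Set.univ := by simpa using hne.ne_empty
    have h₁ : (X.restrict D).Hit := hX.of_subtype (fun _ _ => id) (fun v w hvw hm => by
      by_contra hw
      exact hm ((hD v v.2 w hw).1 hvw).2.1) fun _ => id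
    have h₂ : (X.restrict Dᶜ).Hit := hX.of_subtype (fun _ _ => id) (fun v w hvw hm hw => by
      exact hm ((hD w hw v v.2).1 hvw.symm).2.2) fun _ => id
    have h₃ := ih _ (hcard huniv) h₁ (hereditary_restrict h D) rfl
    have h₄ := ih _ (hcard huniv') h₂ (hereditary_restrict h Dᶜ) rfl
    rw [cls_eq_iff.2 (iso_op_restrict (X := X) (Y := X.restrict Dᶜ) (cr := cr) (mk := True)
      (fun _ _ => Iff.rfl) (fun v hv w => hD v hv w w.2) fun _ => (iff_of_eq (true_and _)).symm)]
    exact h₃.op h₄ cr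
  · have haD : a ∉ D := fun h => hD.not_marked a h ha
    set E := Dᶜ
    have hDE : D = Eᶜ := (compl_compl D).symm
    rw [hDE] at hD hne haD
    have haE : a ∈ E := by simpa using haD
    have : Nonempty E := ⟨⟨a, haE⟩⟩
    have := hne.to_subtype
    have huniv : E ≠ Set.univ := Set.nonempty_compl.1 hne
    have huniv' : Eᶜ ≠ Set.univ := fun h => by simpa [haE] using (h ▸ Set.mem_univ a : a ∈ Eᶜ)
    have h₁ : (X.restrict E).Hit := hX.of_subtype (fun _ _ => id) (fun v w hvw hm => by
      by_contra hw
      exact hD.closed w v hw hvw.symm hm v.2) fun _ => id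
    have h₂ : Marked.Hit (⟨X.G.induce Eᶜ, fun v => X.G.Adj v a⟩ : Marked ↥Eᶜ) :=
      hX.of_subtype (fun _ _ => id) (fun v w hvw hm => by
        by_cases hw : X.M w
        · exact (hm (hD.uniform v v.2 w a hw ha hvw)).elim
        · exact hD.closed v w v.2 hvw hw) fun v hv => (hD.not_marked v v.2 hv).elim
    have h₃ := ih _ (hcard huniv) h₁ (hereditary_restrict h E) rfl
    have h₄ := ih _ (hcard huniv') h₂ (h.of_embedding ⟨fun
      | none => some a
      | some v => some v.1, by
        rintro (_ | u) (_ | v) huv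
        · rfl
        · exact (haD (Option.some.inj huv ▸ v.2)).elim
        · exact (haD (Option.some.inj huv ▸ u.2)).elim
        · exact congrArg some (Subtype.ext (Option.some.inj huv))⟩ (by
        rintro (_ | u) (_ | v)
        · exact iff_of_false X.G.irrefl id
        · exact X.G.adj_comm _ _
        · exact Iff.rfl
        · exact Iff.rfl)) rfl
    rw [cls_eq_iff.2 (iso_op_restrict (X := X) (D := E) (cr := True) (mk := False)
      (Y := ⟨X.G.induce Eᶜ, fun v => X.G.Adj v a⟩) (fun _ _ => Iff.rfl) (fun v hv w => ?_)
      fun w => by simpa using hD.not_marked w w.2)]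
    · exact h₃.pd h₄
    · rw [true_and, X.G.adj_comm]
      refine ⟨fun hvw => ?_, fun hvw => hD.uniform w w.2 a v ha hvw.1 hvw.2⟩
      have hv' : X.M v := by
        by_contra hv'
        exact hD.closed w v w.2 hvw hv' hv
      exact ⟨hv', hD.uniform w w.2 v a hv' ha hvw⟩

end MarkedClass

namespace Marked

variable {V W : Type} {X : Marked V} {Y : Marked W}

theorem hit_of_connected_cone (h : X.cone.Connected) : X.Hit := by
  intro D hD ⟨v, hv⟩
  by_contra! hc
  have key : ∀ u w, X.cone.Walk u w → u ∈ some '' D → w ∈ some '' D := by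
    intro u w p
    induction p with
    | nil => exact id
    | @cons _ x _ hux _ ih =>
      rintro ⟨u, hu, rfl⟩
      refine ih ?_
      obtain _ | x := x
      · exact (hc u hu hux).elim
      · exact ⟨x, hD u x hu hux, rfl⟩
  obtain ⟨p⟩ := h.preconnected (some v) none
  obtain ⟨_, -, h⟩ := key _ _ p ⟨v, hv, rfl⟩
  simp at h

theorem iso_of_cone_iso (e : X.cone ≃g Y.cone) (he : e none = none) : Iso X Y := by
  have h : ∀ v, some (Equiv.removeNone e.toEquiv v) = e (some v) := fun v =>
    Equiv.removeNone_some e.toEquiv (Option.ne_none_iff_exists'.1 fun h' => by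
      simpa using e.injective (h'.trans he.symm))
  refine ⟨Equiv.removeNone e.toEquiv, fun u v => ?_, fun u => ?_⟩
  · rw [← cone_some_some, h, h, e.map_adj_iff, cone_some_some]
  · rw [← cone_none_some, h, ← he, e.map_adj_iff, cone_none_some]

/-- Delete the vertex `r` and mark its neighbours. -/
def del (G : SimpleGraph V) (r : V) : Marked {v // v ≠ r} where
  G := G.induce {v | v ≠ r}
  M v := G.Adj r v

theorem exists_iso_cone_del (G : SimpleGraph V) (r : V) :
    ∃ e : (del G r).cone ≃g G, e none = r := by
  classical
  refine ⟨⟨Equiv.optionSubtypeNe r, ?_⟩, Equiv.optionSubtypeNe_none r⟩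
  rintro (_ | u) (_ | v) <;> simp [del, G.adj_comm]

end Marked

section
open Marked MarkedClass

/-- The connected distance-hereditary graphs on `n` labelled vertices. -/
abbrev ConnDH (n : ℕ) : Type :=
  {G : SimpleGraph (Fin n) // G.Connected ∧ DistanceHereditary G}

/-- Isomorphism of connected distance-hereditary graphs. -/
abbrev ConnDH.Rel (n : ℕ) (G G' : ConnDH n) : Prop := Nonempty (G.val ≃g G'.val)

theorem ConnDH.nonempty_iso_of_mk_eq {n : ℕ} {G G' : ConnDH n}
    (h : Quot.mk (Rel n) G = Quot.mk (Rel n) G') : Nonempty (G.val ≃g G'.val) :=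
  (Equivalence.eqvGen_iff (r := Rel n) ⟨fun _ => ⟨.refl⟩, fun ⟨e⟩ => ⟨e.symm⟩,
    fun ⟨e⟩ ⟨f⟩ => ⟨e.trans f⟩⟩).1 (Quot.eqvGen_exact h)

theorem ConnDH.good_del {n : ℕ} (G : ConnDH (n + 2)) (r : Fin (n + 2)) :
    Good (del G.val r).cls ∧ size (del G.val r).cls = n + 1 := by
  obtain ⟨e, -⟩ := exists_iso_cone_del G.val r
  have : Nonempty {v // v ≠ r} := nontrivial_iff_exists_ne r |>.1 inferInstance |>.elim
    fun v hv => ⟨⟨v, hv⟩⟩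
  refine ⟨good_of_hereditary (hit_of_connected_cone (e.symm.connected_iff.1 G.2.1))
    (((hereditary_iff G.2.1).2 G.2.2).of_iso e.symm), ?_⟩
  rw [size_cls, Nat.card_eq_fintype_card]
  simp

/-- The class obtained by deleting the vertex `r` from a representative of `q`. -/
noncomputable def ConnDH.delete {n : ℕ} (q : Quot (Rel (n + 2))) (r : Fin (n + 2)) :
    level (fun _ => True) (n + 1) :=
  ⟨(del q.out.val r).cls, mem_level.2 ⟨(good_del q.out r).1, trivial, (good_del q.out r).2⟩⟩

theorem numAll_eq_card (n : ℕ) : numAll n = Nat.card (level (fun _ => True) n) := by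
  rw [Nat.card_eq_fintype_card, Fintype.card_coe]; rfl

theorem numConnDH_le_numAll (n : ℕ) : numConnDH (n + 2) ≤ numAll (n + 1) := by
  rw [numAll_eq_card]
  refine Nat.card_le_card_of_injective (fun q => ConnDH.delete q 0) fun q q' h => ?_
  obtain ⟨f⟩ := (cls_eq_iff.1 (congrArg Subtype.val h)).cone
  obtain ⟨e, -⟩ := exists_iso_cone_del q.out.val 0
  obtain ⟨e', -⟩ := exists_iso_cone_del q'.out.val 0
  rw [← q.out_eq, ← q'.out_eq]
  exact Quot.sound ⟨(e.symm.trans f).trans e'⟩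

theorem numAll_le_mul_numConnDH (n : ℕ) :
    numAll (n + 1) ≤ (n + 2) * numConnDH (n + 2) := by
  rw [numAll_eq_card, mul_comm]
  have hc : numConnDH (n + 2) * (n + 2) =
      Nat.card (Quot (ConnDH.Rel (n + 2)) × Fin (n + 2)) := by
    rw [Nat.card_prod, Nat.card_fin]; rfl
  rw [hc]
  refine Nat.card_le_card_of_surjective (fun p => ConnDH.delete p.1 p.2) fun ⟨x, hx⟩ => ?_
  obtain ⟨hx, -, hs⟩ := mem_level.1 hx
  induction x using ind with | _ V X
  rw [size_cls] at hs
  have f : Fin (n + 2) ≃ Option V :=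
    (Finite.equivFinOfCardEq (by rw [Finite.card_option, hs])).symm
  let g : X.cone.comap f ≃g X.cone := SimpleGraph.Iso.comap f X.cone
  have hconn : (X.cone.comap f).Connected := g.connected_iff.2 hx.connected_cone
  let G : ConnDH (n + 2) :=
    ⟨_, hconn, (hereditary_iff hconn).1 (hx.hereditary_cone.of_iso g.symm)⟩
  obtain ⟨e⟩ := ConnDH.nonempty_iso_of_mk_eq (Quot.out_eq (Quot.mk (ConnDH.Rel (n + 2)) G))
  let k : (Quot.mk (ConnDH.Rel (n + 2)) G).out.val ≃g X.cone := e.trans g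
  obtain ⟨d, hd⟩ := exists_iso_cone_del (Quot.mk (ConnDH.Rel (n + 2)) G).out.val (k.symm none)
  refine ⟨(Quot.mk _ G, k.symm none), Subtype.ext (cls_eq_iff.2 (iso_of_cone_iso (d.trans k) ?_))⟩
  simp [hd]

end

theorem eventually_pow_mul_pow_le (k : ℕ) {a b : ℝ} (ha : 0 < a) (hab : a < b) :
    ∀ᶠ n : ℕ in Filter.atTop, (n : ℝ) ^ k * a ^ n ≤ b ^ n := by
  have hb := ha.trans hab
  have h := tendsto_pow_const_mul_const_pow_of_lt_one k (div_pos ha hb).le ((div_lt_one hb).2 hab)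
  filter_upwards [h.eventually_le_const one_pos] with n hn
  rwa [div_pow, ← mul_div_assoc, div_le_one (pow_pos hb n)] at hn

theorem numConnDH_asymptotics :
    ∃ (c C : ℝ), 0 < c ∧ 0 < C ∧ ∃ N : ℕ, ∀ n : ℕ, N ≤ n →
      c * 7.249 ^ n * (n : ℝ) ^ (-(5 : ℝ) / 2) ≤ (numConnDH n : ℝ) ∧
      (numConnDH n : ℝ) ≤ C * 7.25 ^ n * (n : ℝ) ^ (-(5 : ℝ) / 2) := by
  obtain ⟨c, hc, h⟩ := MarkedClass.exists_mul_pow_le_numAll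
  refine ⟨c / 7.2491, 1, by positivity, one_pos, ?_⟩
  rw [← Filter.eventually_atTop]
  filter_upwards [eventually_pow_mul_pow_le 1 (a := 7.249) (b := 7.2491) (by norm_num)
    (by norm_num), eventually_pow_mul_pow_le 3 (a := 7.24999) (b := 7.25) (by norm_num)
    (by norm_num), Filter.eventually_ge_atTop 2] with n h₁ h₂ hn
  obtain ⟨n, rfl⟩ := Nat.exists_eq_add_of_le' hn
  have hn' : (1 : ℝ) ≤ ((n + 2 : ℕ) : ℝ) := by exact_mod_cast (by omega : 1 ≤ n + 2)
  have hpos : (0 : ℝ) < ((n + 2 : ℕ) : ℝ) := by linarith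
  constructor
  · have hl : (MarkedClass.numAll (n + 1) : ℝ) ≤ ((n + 2 : ℕ) : ℝ) * numConnDH (n + 2) := by
      exact_mod_cast numAll_le_mul_numConnDH n
    have hp : ((n + 2 : ℕ) : ℝ) ^ (-(5 : ℝ) / 2) ≤ 1 :=
      Real.rpow_le_one_of_one_le_of_nonpos hn' (by norm_num)
    have hc' : 0 < c / 7.2491 := by positivity
    refine (mul_le_of_le_one_right (by positivity) hp).trans
      (le_of_mul_le_mul_left (le_trans ?_ ((h (n + 1) (by omega)).trans hl)) hpos)
    calc ((n + 2 : ℕ) : ℝ) * (c / 7.2491 * 7.249 ^ (n + 2))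
        = c / 7.2491 * (((n + 2 : ℕ) : ℝ) ^ 1 * 7.249 ^ (n + 2)) := by ring
      _ ≤ c / 7.2491 * 7.2491 ^ (n + 2) := mul_le_mul_of_nonneg_left h₁ hc'.le
      _ = c * 7.2491 ^ (n + 1) := by
        rw [pow_succ _ (n + 1)]
        field_simp
  · have hu : (numConnDH (n + 2) : ℝ) ≤ MarkedClass.numAll (n + 1) := by
      exact_mod_cast numConnDH_le_numAll n
    have hp : ((n + 2 : ℕ) : ℝ) ^ (-(3 : ℝ)) ≤ ((n + 2 : ℕ) : ℝ) ^ (-(5 : ℝ) / 2) :=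
      Real.rpow_le_rpow_of_exponent_le hn' (by norm_num)
    have hp' : ((n + 2 : ℕ) : ℝ) ^ (-(3 : ℝ)) = (((n + 2 : ℕ) : ℝ) ^ 3)⁻¹ := by
      rw [Real.rpow_neg hpos.le]
      norm_cast
    have hu' := MarkedClass.numAll_le_pow (n := n + 1) (by omega)
    have hu'' : (7.24999 : ℝ) ^ (n + 1) ≤ 7.24999 ^ (n + 2) :=
      pow_le_pow_right₀ (by norm_num) (by omega)
    refine (hu.trans (hu'.trans hu'')).trans (le_trans ?_
      (mul_le_mul_of_nonneg_left (hp'.symm.trans_le hp) (by positivity)))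
    rw [one_mul, ← div_eq_mul_inv, le_div_iff₀ (by positivity), mul_comm]
    exact h₂
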